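/- arXiv:2305.06285 — 3 statements merged into one kernel-verified Lean document; each statement's English description precedes it below -/
import Mathlib

section
/- Let μ be a weighted m-ovoid of the polar space P'_{r,e}. Then for every j-dimensional projective subspace π of the ambient projective space PG(n,q) (n = 2r+2e−3), one has μ(π^⊥) + q^{r+e−j−2}·μ(π) = m·(q^{r+e−j−2} + 1). -/
noncomputable section

open scoped BigOperators

namespace PolarOvoids

/-- The kind of the polar space `P'_{r,e}`: the elliptic quadric `Q⁻(2r+1,q)` (`e = 2`),
the symplectic polar space `W(2r-1,q)` (`e = 1`), or the Hermitian polar space `H(2r,q)`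
with `q` a square (`e = 3/2`). -/
inductive PolarKind : Type where
  | elliptic
  | symplectic
  | hermitian

/-- The parameter `e` of the polar space. -/
def PolarKind.e : PolarKind → ℝ
  | .elliptic => 2
  | .symplectic => 1
  | .hermitian => 3 / 2

/-- The dimension `2r + 2e - 2` of the vector space underlying the ambient projective
space `PG(n,q)`, `n = 2r + 2e - 3`. -/
def PolarKind.vdim : PolarKind → ℕ → ℕ
  | .elliptic, r => 2 * r + 2
  | .symplectic, r => 2 * r
  | .hermitian, r => 2 * r + 1

/-- The orthogonal complement (polar image) of a subspace with respect to a
(reflexive) sesquilinear form `B`. -/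
def sperp {F V : Type} [Field F] [AddCommGroup V] [Module F V] {σ : F →+* F}
    (B : V →ₗ[F] V →ₛₗ[σ] F) (W : Submodule F V) : Submodule F V where
  carrier := {v | ∀ w ∈ W, B w v = 0}
  add_mem' := by
    intro a b ha hb w hw
    simp only [map_add, ha w hw, hb w hw, add_zero]
  zero_mem' := by
    intro w hw
    simp
  smul_mem' := by
    intro c v hv w hw
    simp only [map_smulₛₗ, hv w hw, smul_zero]

/-- The set of points of the projective space `PG(n,q)` lying in a projective subspace,
given as the corresponding linear subspace `W`. -/
def pts {F V : Type} [Field F] [AddCommGroup V] [Module F V] (W : Submodule F V) :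
    Set (Projectivization F V) := {p | p.rep ∈ W}

/-- The total weight `μ(S) = ∑_{p ∈ S} μ(p)` of a set `S` of projective points under a
weight function `μ` on the points. -/
def wsum {F V : Type} [Field F] [AddCommGroup V] [Module F V]
    (μ : Projectivization F V → ℕ) (S : Set (Projectivization F V)) : ℝ :=
  ∑ᶠ p ∈ S, (μ p : ℝ)

/-- The weight `μ(S) = |S ∩ O|` of a point set `S` with respect to the point set `O`. -/
def nwt {X : Type} (O S : Set X) : ℝ := ((S ∩ O).ncard : ℝ)

/-- The defining property of each kind of polar space, in terms of the companion
automorphism `σ`, the sesquilinear form `B` inducing the polarity, the point set `sing`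
of the polar space and the predicate `ti` of total isotropy (resp. total singularity):
* symplectic: `B` is a non-degenerate alternating bilinear form;
* Hermitian: `B` is a non-degenerate Hermitian form with respect to the involutory field
  automorphism `σ` (so the field order is a square `q` and `σ : x ↦ x^√q`);
* elliptic: `B` is the bilinear form associated to a non-singular quadratic form `Q`,
  of Witt index `r` (imposed by the rank axioms below). -/
def PolarKind.Spec {F : Type} [Field F] {N : ℕ} :
    (k : PolarKind) → (σ : F →+* F) →
    ((Fin N → F) →ₗ[F] (Fin N → F) →ₛₗ[σ] F) →
    Set (Projectivization F (Fin N → F)) →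
    (Submodule F (Fin N → F) → Prop) → Prop
  | .symplectic, σ, B, sing, ti =>
      σ = RingHom.id F ∧ (∀ v, B v v = 0) ∧ sing = Set.univ ∧
        ∀ W, ti W ↔ ∀ v ∈ W, ∀ w ∈ W, B v w = 0
  | .hermitian, σ, B, sing, ti =>
      σ ≠ RingHom.id F ∧ σ.comp σ = RingHom.id F ∧
        (∀ v w, B w v = σ (B v w)) ∧
        sing = {p | B p.rep p.rep = 0} ∧
        ∀ W, ti W ↔ ∀ v ∈ W, ∀ w ∈ W, B v w = 0
  | .elliptic, σ, B, sing, ti =>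
      σ = RingHom.id F ∧
        ∃ Q : QuadraticForm F (Fin N → F),
          (∀ v w, QuadraticMap.polar (⇑Q) v w = B v w) ∧
          sing = {p | Q p.rep = 0} ∧
          ∀ W, ti W ↔ ∀ v ∈ W, Q v = 0

/-- A finite classical polar space `P'_{r,e}` of rank `r` and kind `k` over the finite
field `F` (of order `q`), consisting of the totally isotropic (resp. totally singular)
subspaces with respect to the defining form.  Its ambient projective space is
`PG(2r + 2e - 3, q)`, whose points are the points of `Projectivization F (Fin (k.vdim r) → F)`
and whose `j`-dimensional projective subspaces correspond to the linear subspaces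
`W : Submodule F (Fin (k.vdim r) → F)` with `Module.finrank F W = j + 1`.
The polarity `⊥` of the ambient projective space is induced by the non-degenerate
reflexive (sesquilinear) form `B`; the rank axioms state that the Witt index is `r`,
i.e. generators have projective dimension `r - 1`. -/
structure PolarSpace (F : Type) [Field F] (r : ℕ) (k : PolarKind) where
  σ : F →+* F
  B : (Fin (k.vdim r) → F) →ₗ[F] (Fin (k.vdim r) → F) →ₛₗ[σ] F
  nondeg : ∀ v, (∀ w, B v w = 0) → v = 0
  sing : Set (Projectivization F (Fin (k.vdim r) → F))
  ti : Submodule F (Fin (k.vdim r) → F) → Prop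
  spec : k.Spec σ B sing ti
  rank_exists : ∃ W, ti W ∧ Module.finrank F ↥W = r
  rank_le : ∀ W, ti W → Module.finrank F ↥W ≤ r

namespace PolarSpace

variable {F : Type} [Field F] {r : ℕ} {k : PolarKind}

/-- The image `π^⊥` of a subspace `π` under the polarity of the ambient projective space. -/
def perp (P : PolarSpace F r k) (W : Submodule F (Fin (k.vdim r) → F)) :
    Submodule F (Fin (k.vdim r) → F) := sperp P.B W

/-- The image `p^⊥` of a point `p` under the polarity of the ambient projective space. -/
def pperp (P : PolarSpace F r k) (p : Projectivization F (Fin (k.vdim r) → F)) :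
    Submodule F (Fin (k.vdim r) → F) := sperp P.B (Submodule.span F {p.rep})

/-- A generator: a maximal totally isotropic (totally singular) subspace, i.e. one of
projective dimension `r - 1`. -/
def IsGenerator (P : PolarSpace F r k) (W : Submodule F (Fin (k.vdim r) → F)) : Prop :=
  P.ti W ∧ Module.finrank F ↥W = r

/-- An `m`-ovoid: a set `O` of points of the polar space such that every generator
contains exactly `m` points of `O`. -/
def IsMOvoid (P : PolarSpace F r k) (m : ℕ)
    (O : Set (Projectivization F (Fin (k.vdim r) → F))) : Prop :=
  O ⊆ P.sing ∧ ∀ W, P.IsGenerator W → (pts W ∩ O).ncard = m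

/-- A non-trivial `m`-ovoid: an `m`-ovoid with `0 < m < θ_{r-1} = (q^r - 1)/(q - 1)`,
the number of points of a generator. -/
def IsNontrivialMOvoid [Fintype F] (P : PolarSpace F r k) (m : ℕ)
    (O : Set (Projectivization F (Fin (k.vdim r) → F))) : Prop :=
  P.IsMOvoid m O ∧ 0 < m ∧ m < ∑ i ∈ Finset.range r, Fintype.card F ^ i

/-- A weighted `m`-ovoid: a function `μ` assigning a natural number to each point of the
ambient projective space, vanishing on points not in the polar space, such that
`μ(p^⊥) + q^{r+e-2}·μ(p) = m·(q^{r+e-2} + 1)` for every point `p` of `PG(n,q)`. -/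
def IsWeightedMOvoid [Fintype F] (P : PolarSpace F r k) (m : ℕ)
    (μ : Projectivization F (Fin (k.vdim r) → F) → ℕ) : Prop :=
  (∀ p, p ∉ P.sing → μ p = 0) ∧
  ∀ p, wsum μ (pts (P.pperp p)) +
      (Fintype.card F : ℝ) ^ ((r : ℝ) + k.e - 2) * (μ p : ℝ)
    = (m : ℝ) * ((Fintype.card F : ℝ) ^ ((r : ℝ) + k.e - 2) + 1)

end PolarSpace

section Counting

variable {F V : Type} [Field F] [AddCommGroup V] [Module F V]

theorem rep_mk_mem_iff (W : Submodule F V) (v : V) (hv : v ≠ 0) :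
    (Projectivization.mk F v hv).rep ∈ W ↔ v ∈ W := by
  obtain ⟨a, ha⟩ := Projectivization.exists_smul_eq_mk_rep F v hv
  rw [← ha, Units.smul_def, Submodule.smul_mem_iff _ a.ne_zero]

theorem range_map_subtype (W : Submodule F V) :
    Set.range (Projectivization.map W.subtype W.injective_subtype) = pts W := by
  ext p
  constructor
  · rintro ⟨p, rfl⟩
    induction p using Projectivization.ind with
    | h v hv => exact (rep_mk_mem_iff W _ _).2 v.2
  · intro hp
    refine ⟨Projectivization.mk F (⟨p.rep, hp⟩ : W) fun h ↦
      p.rep_nonzero (congrArg Subtype.val h), ?_⟩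
    exact p.mk_rep

/-- The number of points of a projective subspace. -/
theorem ncard_pts_mul [Fintype F] [FiniteDimensional F V] (W : Submodule F V) :
    ((pts W).ncard : ℝ) * ((Fintype.card F : ℝ) - 1) =
      (Fintype.card F : ℝ) ^ Module.finrank F W - 1 := by
  have hcard : (pts W).ncard = ∑ i ∈ Finset.range (Module.finrank F W), Fintype.card F ^ i := by
    rw [← range_map_subtype, ← Set.image_univ,
      Set.ncard_image_of_injective _ (Projectivization.map_injective _ W.injective_subtype),
      Set.ncard_univ, Projectivization.card_of_finrank F W rfl, Nat.card_eq_fintype_card]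
  rw [hcard]
  push_cast
  exact geom_sum_mul _ _

theorem finrank_inf_ker_add_one [FiniteDimensional F V] (W : Submodule F V) (f : V →ₗ[F] F)
    (hf : ∃ w ∈ W, f w ≠ 0) :
    Module.finrank F (W ⊓ LinearMap.ker f : Submodule F V) + 1 = Module.finrank F W := by
  obtain ⟨w, hw, hfw⟩ := hf
  have hne : (f.domRestrict W : Module.Dual F W) ≠ 0 := fun h ↦
    hfw (LinearMap.congr_fun h (⟨w, hw⟩ : W))
  rw [← Module.Dual.finrank_ker_add_one_of_ne_zero hne, ← Submodule.map_comap_subtype,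
    ← LinearMap.ker_comp, Submodule.finrank_map_subtype_eq]
  rfl

theorem wsum_eq_sum [Fintype (Projectivization F V)] (μ : Projectivization F V → ℕ)
    (S : Set (Projectivization F V)) [DecidablePred (· ∈ S)] :
    wsum μ S = ∑ p, if p ∈ S then (μ p : ℝ) else 0 := by
  rw [wsum, finsum_mem_def, finsum_eq_sum_of_fintype]
  simp [Set.indicator_apply]

theorem mem_pts_sperp_span_rep {σ : F →+* F} (B : V →ₗ[F] V →ₛₗ[σ] F)
    (p x : Projectivization F V) :
    x ∈ pts (sperp B (Submodule.span F {p.rep})) ↔ B p.rep x.rep = 0 := by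
  constructor
  · exact fun h ↦ h _ (Submodule.mem_span_singleton_self _)
  · intro h w hw
    obtain ⟨c, rfl⟩ := Submodule.mem_span_singleton.1 hw
    simp [h]

/-- The number of points of `W` lying on the hyperplane dual to `x`. -/
theorem ncard_pts_inf_ker_flip_mul [Fintype F] [FiniteDimensional F V] {σ : F →+* F}
    (B : V →ₗ[F] V →ₛₗ[σ] F) (W : Submodule F V) {j : ℕ} (hW : Module.finrank F W = j + 1)
    (x : Projectivization F V) [Decidable (x ∈ pts (sperp B W))] :
    ((pts (W ⊓ LinearMap.ker (B.flip x.rep))).ncard : ℝ) * ((Fintype.card F : ℝ) - 1) =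
      (Fintype.card F : ℝ) ^ j - 1 + (if x ∈ pts (sperp B W) then
        (Fintype.card F : ℝ) ^ j * ((Fintype.card F : ℝ) - 1) else 0) := by
  rw [ncard_pts_mul]
  split_ifs with hx
  · have hle : W ≤ LinearMap.ker (B.flip x.rep) := fun w hw ↦ hx w hw
    rw [inf_eq_left.2 hle, hW]
    ring
  · have hx' : ∃ w ∈ W, B.flip x.rep w ≠ 0 := by
      by_contra! h
      exact hx fun w hw ↦ h w hw
    have := finrank_inf_ker_add_one W _ hx'
    rw [hW, Nat.add_right_cancel_iff] at this
    rw [this, add_zero]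

/-- Double counting the incidences between the points of `W` and their polar hyperplanes. -/
theorem sum_wsum_sperp_mul [Fintype F] [FiniteDimensional F V]
    [Fintype (Projectivization F V)] {σ : F →+* F} (B : V →ₗ[F] V →ₛₗ[σ] F)
    (μ : Projectivization F V → ℕ) (W : Submodule F V) [DecidablePred (· ∈ pts W)] {j : ℕ}
    (hW : Module.finrank F W = j + 1) :
    (∑ p, if p ∈ pts W then wsum μ (pts (sperp B (Submodule.span F {p.rep}))) else 0) *
        ((Fintype.card F : ℝ) - 1) =
      ((Fintype.card F : ℝ) ^ j - 1) * wsum μ Set.univ +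
        (Fintype.card F : ℝ) ^ j * ((Fintype.card F : ℝ) - 1) * wsum μ (pts (sperp B W)) := by
  classical
  have hcount : ∀ x : Projectivization F V,
      (∑ p, if p ∈ pts W ∧ B p.rep x.rep = 0 then (1 : ℝ) else 0) =
        (pts (W ⊓ LinearMap.ker (B.flip x.rep))).ncard := by
    intro x
    rw [Finset.sum_boole, ← Set.ncard_coe_finset]
    congr 2
    ext p
    simp only [Finset.coe_filter, Finset.mem_univ, true_and]
    rfl
  have hswap : (∑ p, if p ∈ pts W then wsum μ (pts (sperp B (Submodule.span F {p.rep}))) else 0) =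
      ∑ x, (μ x : ℝ) * (pts (W ⊓ LinearMap.ker (B.flip x.rep))).ncard := by
    simp_rw [← hcount, Finset.mul_sum]
    rw [Finset.sum_comm]
    refine Finset.sum_congr rfl fun p _ ↦ ?_
    split_ifs with hp
    · simp [wsum_eq_sum, mem_pts_sperp_span_rep, hp]
    · simp [hp]
  rw [hswap, wsum_eq_sum, wsum_eq_sum, Finset.sum_mul, Finset.mul_sum, Finset.mul_sum,
    ← Finset.sum_add_distrib]
  refine Finset.sum_congr rfl fun x _ ↦ ?_
  rw [mul_assoc, ncard_pts_inf_ker_flip_mul B W hW]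
  simp only [Set.mem_univ, if_true]
  split_ifs <;> ring

end Counting

namespace PolarSpace

variable {F : Type} [Field F] {r : ℕ} {k : PolarKind}

theorem eq_zero_symm (P : PolarSpace F r k) {v w : Fin (k.vdim r) → F} (h : P.B v w = 0) :
    P.B w v = 0 := by
  revert h
  obtain ⟨σ, B, -, sing, ti, spec, -, -⟩ := P
  change B v w = 0 → B w v = 0
  intro h
  cases k with
  | symplectic =>
    have hvw := spec.2.1 (v + w)
    simpa [spec.2.1 v, spec.2.1 w, h] using hvw
  | hermitian => rw [spec.2.2.1 v w, h, map_zero]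
  | elliptic =>
    obtain ⟨-, Q, hQ, -⟩ := spec
    rw [← hQ, QuadraticMap.polar_comm, hQ, h]

theorem pts_perp_top (P : PolarSpace F r k) : pts (P.perp ⊤) = ∅ := by
  refine Set.eq_empty_of_forall_notMem fun p hp ↦ p.rep_nonzero (P.nondeg _ fun w ↦ ?_)
  exact P.eq_zero_symm (hp w trivial)

/-- The defining identity of a weighted `m`-ovoid summed over the points of a subspace. -/
theorem IsWeightedMOvoid.sum_identity [Fintype F] {P : PolarSpace F r k} {m : ℕ}
    {μ : Projectivization F (Fin (k.vdim r) → F) → ℕ} (hμ : P.IsWeightedMOvoid m μ)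
    {W : Submodule F (Fin (k.vdim r) → F)} {j : ℕ} (hW : Module.finrank F W = j + 1) :
    ((Fintype.card F : ℝ) ^ j - 1) * wsum μ Set.univ +
        (Fintype.card F : ℝ) ^ j * ((Fintype.card F : ℝ) - 1) * wsum μ (pts (P.perp W)) +
        (Fintype.card F : ℝ) ^ ((r : ℝ) + k.e - 2) * ((Fintype.card F : ℝ) - 1) * wsum μ (pts W) =
      (m : ℝ) * ((Fintype.card F : ℝ) ^ ((r : ℝ) + k.e - 2) + 1) *
        ((Fintype.card F : ℝ) ^ (j + 1) - 1) := by
  classical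
  have := Fintype.ofFinite (Projectivization F (Fin (k.vdim r) → F))
  have hcard : ((pts W).ncard : ℝ) = ∑ p, if p ∈ pts W then (1 : ℝ) else 0 := by
    rw [Finset.sum_boole, ← Set.ncard_coe_finset]
    congr 2
    ext p
    simp
  rw [perp, ← sum_wsum_sperp_mul P.B μ W hW, ← hW, ← ncard_pts_mul W, hcard, wsum_eq_sum μ (pts W)]
  simp only [Finset.sum_mul, Finset.mul_sum, ← Finset.sum_add_distrib]
  refine Finset.sum_congr rfl fun p _ ↦ ?_
  split_ifs
  · have hp := hμ.2 p
    rw [pperp] at hp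
    linear_combination ((Fintype.card F : ℝ) - 1) * hp
  · ring

theorem rpow_sq_mul_sq [Fintype F] (r : ℕ) (k : PolarKind) :
    ((Fintype.card F : ℝ) ^ ((r : ℝ) + k.e - 2)) ^ 2 * (Fintype.card F : ℝ) ^ 2 =
      (Fintype.card F : ℝ) ^ k.vdim r := by
  have hq : (0 : ℝ) < Fintype.card F := by exact_mod_cast Fintype.card_pos
  rw [← Real.rpow_natCast (_ ^ _) 2, ← Real.rpow_mul hq.le, ← Real.rpow_natCast _ 2,
    ← Real.rpow_add hq, ← Real.rpow_natCast _ (k.vdim r)]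
  congr 1
  cases k <;> simp only [PolarKind.e, PolarKind.vdim] <;> push_cast <;> ring

/-- The total weight of a weighted `m`-ovoid. -/
theorem IsWeightedMOvoid.wsum_univ [Fintype F] {P : PolarSpace F r k} {m : ℕ}
    {μ : Projectivization F (Fin (k.vdim r) → F) → ℕ} (hμ : P.IsWeightedMOvoid m μ)
    (hpos : 0 < k.vdim r) :
    wsum μ Set.univ =
      (m : ℝ) * ((Fintype.card F : ℝ) ^ ((r : ℝ) + k.e - 2) * (Fintype.card F : ℝ) + 1) := by
  obtain ⟨n, hn⟩ := Nat.exists_eq_succ_of_ne_zero hpos.ne'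
  have hsum := hμ.sum_identity (W := ⊤) (j := n) (by simpa using hn)
  have htop : pts (⊤ : Submodule F (Fin (k.vdim r) → F)) = Set.univ := by
    ext p
    simp [pts]
  have hsq := rpow_sq_mul_sq (F := F) r k
  have hq : (1 : ℝ) < Fintype.card F := by exact_mod_cast Fintype.one_lt_card
  have hpow : (1 : ℝ) < (Fintype.card F : ℝ) ^ k.vdim r := one_lt_pow₀ hq hpos.ne'
  have hA : (0 : ℝ) < (Fintype.card F : ℝ) ^ ((r : ℝ) + k.e - 2) :=
    Real.rpow_pos_of_pos (by linarith) _
  rw [P.pts_perp_top, htop] at hsum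
  simp only [wsum, Set.mem_empty_iff_false, finsum_false, finsum_zero] at hsum ⊢
  rw [hn, Nat.succ_eq_add_one] at hsq hpow
  generalize (Fintype.card F : ℝ) ^ ((r : ℝ) + k.e - 2) = A at *
  generalize (∑ᶠ p ∈ Set.univ, (μ p : ℝ)) = T at *
  generalize (Fintype.card F : ℝ) = q at *
  have hAq : A * q ≠ 1 := by
    intro h
    nlinarith
  have hfac : q * ((A + 1) * (A * q - 1)) ≠ 0 := by
    have := sub_ne_zero.2 hAq
    positivity
  refine mul_left_cancel₀ hfac ?_
  rw [pow_succ] at hsq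
  linear_combination q * hsum + (T - m * q * (A + 1)) * hsq

end PolarSpace

/-- Lemma 3.1: if `μ` is a weighted `m`-ovoid of `P'_{r,e}`, then for every
`j`-dimensional projective subspace `π` of the ambient projective space `PG(n,q)`
(`n = 2r + 2e - 3`) one has `μ(π^⊥) + q^{r+e-j-2}·μ(π) = m·(q^{r+e-j-2} + 1)`. -/
theorem weighted_ovoid_subspace_identity
    {F : Type} [Field F] [Fintype F] {q r m j : ℕ} (hq : Fintype.card F = q)
    {k : PolarKind} (P : PolarSpace F r k)
    (μ : Projectivization F (Fin (k.vdim r) → F) → ℕ)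
    (hμ : P.IsWeightedMOvoid m μ)
    (W : Submodule F (Fin (k.vdim r) → F)) (hW : Module.finrank F ↥W = j + 1) :
    wsum μ (pts (P.perp W)) +
        (q : ℝ) ^ ((r : ℝ) + k.e - (j : ℝ) - 2) * wsum μ (pts W)
      = (m : ℝ) * ((q : ℝ) ^ ((r : ℝ) + k.e - (j : ℝ) - 2) + 1) := by
  subst hq
  have hle : Module.finrank F W ≤ k.vdim r := by
    simpa using Submodule.finrank_le W
  have htotal := hμ.wsum_univ (by omega)
  have hsum := hμ.sum_identity hW
  have hq : (1 : ℝ) < Fintype.card F := by exact_mod_cast Fintype.one_lt_card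
  have hexp : (r : ℝ) + k.e - (j : ℝ) - 2 = (r : ℝ) + k.e - 2 - (j : ℝ) := by ring
  rw [hexp, Real.rpow_sub (by linarith), Real.rpow_natCast]
  rw [htotal] at hsum
  generalize (Fintype.card F : ℝ) ^ ((r : ℝ) + k.e - 2) = A at *
  generalize (Fintype.card F : ℝ) = q at *
  have hq1 : q - 1 ≠ 0 := by linarith
  have hqj : q ^ j ≠ 0 := pow_ne_zero _ (by linarith)
  field_simp
  refine mul_left_cancel₀ hq1 ?_
  linear_combination hsum

end PolarOvoids
end
end

section
/- Let O be a non-trivial m-ovoid of the polar space P'_{r,e} with weight function μ, and let p₀ ∈ O. Then Σ_{p ∈ P'_{r,e}∖{p₀}} μ(p)·μ(⟨p₀,p⟩) ≥ 2·(m·(q^{r+e−1}+1) − 1), where the sum is over the points of P'_{r,e} other than p₀ and ⟨p₀,p⟩ denotes the projective line through p₀ and p. -/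
noncomputable section

open scoped BigOperators

namespace PolarOvoids

/-- The functional `w ↦ B w v` on `W`, as an additive function of `v`. -/
def restrictedPairing {F V : Type} [Field F] [AddCommGroup V] [Module F V] {σ : F →+* F}
    (B : V →ₗ[F] V →ₛₗ[σ] F) (W : Submodule F V) : V →+ Module.Dual F W where
  toFun v := (B.flip v) ∘ₗ W.subtype
  map_zero' := by ext; simp
  map_add' x y := by ext; simp

@[simp]
lemma restrictedPairing_apply {F V : Type} [Field F] [AddCommGroup V] [Module F V] {σ : F →+* F}
    (B : V →ₗ[F] V →ₛₗ[σ] F) (W : Submodule F V) (v : V) (w : W) :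
    restrictedPairing B W v w = B w v := rfl

lemma restrictedPairing_surjective {F V : Type} [Field F] [Finite F] [AddCommGroup V]
    [Module F V] [FiniteDimensional F V] {σ : F →+* F} (B : V →ₗ[F] V →ₛₗ[σ] F)
    (nondeg : ∀ v, (∀ w, B v w = 0) → v = 0) (W : Submodule F V) :
    Function.Surjective (restrictedPairing B W) := by
  have hσ : Function.Surjective σ := Finite.surjective_of_injective σ.injective
  let U : Submodule F (Module.Dual F W) :=
    { carrier := Set.range (restrictedPairing B W)
      add_mem' := by
        rintro _ _ ⟨x, rfl⟩ ⟨y, rfl⟩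
        exact ⟨x + y, map_add _ _ _⟩
      zero_mem' := ⟨0, map_zero _⟩
      smul_mem' := by
        rintro c _ ⟨x, rfl⟩
        obtain ⟨d, rfl⟩ := hσ c
        exact ⟨d • x, by ext w; simp⟩ }
  have hU : U.dualCoannihilator = ⊥ := by
    rw [eq_bot_iff]
    intro w hw
    rw [Submodule.mem_dualCoannihilator] at hw
    have : (w : V) = 0 := nondeg _ fun v => hw (restrictedPairing B W v) ⟨v, rfl⟩
    simpa using this
  have hU' : U = ⊤ := by
    rw [← Subspace.dualCoannihilator_dualAnnihilator_eq (W := U), hU,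
      Submodule.dualAnnihilator_bot]
  intro f
  have : f ∈ U := hU' ▸ Submodule.mem_top
  exact this

lemma card_fiber_mul_card {G K : Type} [AddGroup G] [AddGroup K] [Fintype G] [Fintype K]
    [DecidableEq K] (g : G →+ K) (hg : Function.Surjective g) (y : K) :
    (Finset.univ.filter fun x => g x = y).card * Fintype.card K = Fintype.card G := by
  have h : ∀ z ∈ (Finset.univ : Finset K), (Finset.univ.filter fun x => g x = z).card
      = (Finset.univ.filter fun x => g x = y).card := fun z _ =>
    AddMonoidHom.card_fiber_eq_of_mem_range g (hg z) (hg y)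
  rw [← Finset.card_univ (α := G), Finset.card_eq_sum_card_fiberwise (s := Finset.univ)
    (t := Finset.univ) (f := g) (by simp), Finset.sum_congr rfl h]
  simp [mul_comm]

open scoped Classical in
lemma card_dual_apply_eq_zero_mul {F U : Type} [Field F] [Fintype F] [AddCommGroup U] [Module F U]
    [Fintype (Module.Dual F U)] {x : U} (hx : x ≠ 0) :
    (Finset.univ.filter fun f : Module.Dual F U => f x = 0).card * Fintype.card F
      = Fintype.card (Module.Dual F U) := by
  refine card_fiber_mul_card (Module.Dual.eval F U x : Module.Dual F U →ₗ[F] F).toAddMonoidHom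
    ?_ 0
  obtain ⟨f, hf⟩ : ∃ f : Module.Dual F U, f x ≠ 0 := by
    by_contra! h
    exact hx ((Module.forall_dual_apply_eq_zero_iff F x).1 h)
  intro c
  exact ⟨(c / f x) • f, by simp [hf]⟩

/-- A point off the hyperplane `H` in the span of `H` and `u` has a representative in
the coset `u + H`. -/
lemma exists_unit_smul_sub_mem {F V : Type} [Field F] [AddCommGroup V] [Module F V]
    {H : Submodule F V} {u v : V}
    (hv : v ∈ H ⊔ Submodule.span F {u}) (hvH : v ∉ H) :
    ∃ c : Fˣ, (c : F) • v - u ∈ H := by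
  obtain ⟨h, hh, y, hy, rfl⟩ := Submodule.mem_sup.1 hv
  obtain ⟨d, rfl⟩ := Submodule.mem_span_singleton.1 hy
  have hd : d ≠ 0 := by
    rintro rfl
    simp [hh] at hvH
  refine ⟨(Units.mk0 d hd)⁻¹, ?_⟩
  have : ((Units.mk0 d hd)⁻¹ : Fˣ) • (h + d • u) - u = d⁻¹ • h := by
    simp [Units.smul_def, smul_smul, hd]
  rw [← Units.smul_def, this]
  exact H.smul_mem _ hh

section counting

variable {F V : Type} [Field F] [Fintype F] [AddCommGroup V] [Module F V] [Fintype V]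
  {σ : F →+* F} {B : V →ₗ[F] V →ₛₗ[σ] F} {W : Submodule F V}
  {O : Set (Projectivization F V)} {m : ℕ}

open scoped Classical in
/-- Double counting between the singular vectors and the representatives of points of `O` that
induce a fixed non-zero functional `f` on `W`. -/
lemma card_singular_mul_le (hW : ∀ v ∈ W, ∀ w ∈ W, B v w = 0) (s : V → Prop)
    (hO : ∀ H ≤ W, ∀ u, s u → (∀ h ∈ H, B h u = 0) →
      Module.finrank F ↥(H ⊔ Submodule.span F {u}) = Module.finrank F W →
      (pts (H ⊔ Submodule.span F {u}) ∩ O).ncard = m)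
    [Fintype (Projectivization F V)] {f : Module.Dual F W} (hf : f ≠ 0) :
    ((Finset.univ.filter fun u => s u ∧ restrictedPairing B W u = f).card : ℝ) *
        (m - (pts ((LinearMap.ker f).map W.subtype) ∩ O).ncard)
      ≤ ((Finset.univ.filter fun x : Projectivization F V × Fˣ =>
          x.1 ∈ O ∧ restrictedPairing B W ((x.2 : F) • x.1.rep) = f).card : ℝ) *
        (Fintype.card F : ℝ) ^ (Module.finrank F W - 1) := by
  set H := (LinearMap.ker f).map W.subtype with hH
  have hHW : H ≤ W := by
    rw [hH]; exact Submodule.map_subtype_le _ _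
  have hHf : Module.finrank F H + 1 = Module.finrank F W := by
    rw [hH, Submodule.finrank_map_subtype_eq, Module.Dual.finrank_ker_add_one_of_ne_zero hf]
  set S := Finset.univ.filter fun u => s u ∧ restrictedPairing B W u = f
  set A := Finset.univ.filter fun x : Projectivization F V × Fˣ =>
          x.1 ∈ O ∧ restrictedPairing B W ((x.2 : F) • x.1.rep) = f
  let R : V → Projectivization F V × Fˣ → Prop := fun u x => (x.2 : F) • x.1.rep - u ∈ H
  have hdc := Finset.sum_card_bipartiteAbove_eq_sum_card_bipartiteBelow (s := S) (t := A) R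
  have hlow : ∀ u ∈ S, (m - (pts H ∩ O).ncard : ℝ) ≤ ((A.bipartiteAbove R u).card : ℝ) := by
    intro u hu
    obtain ⟨hsu, huf⟩ := (Finset.mem_filter.1 hu).2
    have hHu : ∀ h ∈ H, B h u = 0 := by
      rintro _ ⟨h, hh, rfl⟩
      have := DFunLike.congr_fun huf h
      simpa [LinearMap.mem_ker.1 hh] using this
    have huH : u ∉ H := by
      intro hu'
      refine hf ?_
      rw [← huf]
      ext w
      exact hW _ w.2 _ (hHW hu')
    have hfin : Module.finrank F ↥(H ⊔ Submodule.span F {u}) = Module.finrank F W := by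
      rw [← hHf, Submodule.finrank_sup_span_singleton huH]
    have hm := hO H hHW u hsu hHu hfin
    have hc : ∀ p : Projectivization F V, ∃ c : Fˣ,
        p ∈ (pts (H ⊔ Submodule.span F {u}) ∩ O) \ (pts H ∩ O) → (c : F) • p.rep - u ∈ H := by
      intro p
      by_cases hp : p ∈ (pts (H ⊔ Submodule.span F {u}) ∩ O) \ (pts H ∩ O)
      · obtain ⟨c, hc⟩ := exists_unit_smul_sub_mem hp.1.1 fun h => hp.2 ⟨h, hp.1.2⟩
        exact ⟨c, fun _ => hc⟩
      · exact ⟨1, fun h => absurd h hp⟩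
    choose c hc using hc
    have hle : ((pts (H ⊔ Submodule.span F {u}) ∩ O) \ (pts H ∩ O)).ncard
        ≤ (A.bipartiteAbove R u).card := by
      rw [← Set.ncard_coe_finset]
      refine Set.ncard_le_ncard_of_injOn (fun p => (p, c p)) ?_ ?_ (Set.toFinite _)
      · intro p hp
        simp only [Finset.mem_coe, Finset.mem_bipartiteAbove, A, Finset.mem_filter,
          Finset.mem_univ, true_and]
        refine ⟨⟨hp.1.2, ?_⟩, hc p hp⟩
        rw [← sub_eq_zero, ← huf, ← map_sub]
        ext w
        exact hW _ w.2 _ (hHW (hc p hp))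
      · intro p _ p' _ h
        exact congrArg Prod.fst h
    have hdiff := Set.le_ncard_sdiff (pts H ∩ O) (pts (H ⊔ Submodule.span F {u}) ∩ O)
      (Set.toFinite _)
    rw [hm] at hdiff
    have : m ≤ (A.bipartiteAbove R u).card + (pts H ∩ O).ncard := by omega
    have : (m : ℝ) ≤ (A.bipartiteAbove R u).card + (pts H ∩ O).ncard := by exact_mod_cast this
    linarith
  have hup : ∀ x ∈ A, (S.bipartiteBelow R x).card
      ≤ Fintype.card F ^ (Module.finrank F W - 1) := by
    intro x _
    have hcard : Fintype.card F ^ (Module.finrank F W - 1) = Fintype.card H := by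
      rw [Module.card_eq_pow_finrank (K := F) (V := H), ← hHf, Nat.add_sub_cancel]
    rw [hcard, ← Finset.card_univ]
    refine Finset.card_le_card_of_surjOn
      (fun h : H => (x.2 : F) • x.1.rep - (h : V)) ?_
    intro u hu
    refine ⟨⟨_, (Finset.mem_bipartiteBelow _).1 hu |>.2⟩, by simp, by simp⟩
  calc _ = ∑ u ∈ S, (m - (pts H ∩ O).ncard : ℝ) := by rw [Finset.sum_const, nsmul_eq_mul]
    _ ≤ ∑ u ∈ S, ((A.bipartiteAbove R u).card : ℝ) := Finset.sum_le_sum hlow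
    _ = ∑ x ∈ A, ((S.bipartiteBelow R x).card : ℝ) := by exact_mod_cast hdc
    _ ≤ ∑ x ∈ A, (Fintype.card F : ℝ) ^ (Module.finrank F W - 1) :=
        Finset.sum_le_sum fun x hx => by exact_mod_cast hup x hx
    _ = _ := by simp

open scoped Classical in
/-- The lower bound for the size of an `m`-ovoid, obtained by projecting from a generator `W`. -/
lemma mul_add_one_le_ncard (hW : ∀ v ∈ W, ∀ w ∈ W, B v w = 0) (s : V → Prop)
    (hO : ∀ H ≤ W, ∀ u, s u → (∀ h ∈ H, B h u = 0) →
      Module.finrank F ↥(H ⊔ Submodule.span F {u}) = Module.finrank F W →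
      (pts (H ⊔ Submodule.span F {u}) ∩ O).ncard = m)
    (hWO : (pts W ∩ O).ncard = m) (hr : 0 < Module.finrank F W) {N : ℝ} (hN0 : 0 ≤ N)
    (hN : ∀ f : Module.Dual F W, f ≠ 0 →
      N ≤ ((Finset.univ.filter fun u => s u ∧ restrictedPairing B W u = f).card : ℝ)) :
    (m : ℝ) * (N + 1) ≤ O.ncard := by
  have : Fintype (Projectivization F V) := Fintype.ofFinite _
  have : Finite (Module.Dual F W) := Module.finite_of_finite F
  have : Fintype (Module.Dual F W) := Fintype.ofFinite _
  set q : ℝ := (Fintype.card F : ℝ) with hq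
  have hq1 : 1 < q := by rw [hq]; exact_mod_cast Fintype.one_lt_card
  obtain ⟨n, hn⟩ : ∃ n, Module.finrank F W = n + 1 := ⟨_, (Nat.succ_pred_eq_of_pos hr).symm⟩
  have hdual : Fintype.card (Module.Dual F W) = Fintype.card F ^ (n + 1) := by
    rw [Module.card_eq_pow_finrank (K := F), Subspace.dual_finrank_eq, hn]
  let D : Finset (Module.Dual F W) := Finset.univ.erase 0
  let A : Module.Dual F W → Finset (Projectivization F V × Fˣ) := fun f =>
    Finset.univ.filter fun x => x.1 ∈ O ∧ restrictedPairing B W ((x.2 : F) • x.1.rep) = f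
  let I : Module.Dual F W → ℕ := fun f => (pts ((LinearMap.ker f).map W.subtype) ∩ O).ncard
  have hI : ∀ f, I f ≤ m := fun f => by
    rw [← hWO]
    refine Set.ncard_le_ncard ?_ (Set.toFinite _)
    exact Set.inter_subset_inter_left _ fun p hp => Submodule.map_subtype_le _ _ hp
  -- the representatives of points of `O \ W`
  have hA : ∑ f ∈ D, ((A f).card : ℝ) ≤ (O.ncard - m) * (q - 1) := by
    have h1 : ∑ f ∈ D, (A f).card ≤ (O \ (pts W ∩ O)).ncard * (Fintype.card F - 1) := by
      rw [← Finset.card_biUnion, ← Fintype.card_units, ← Finset.card_univ,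
        Set.ncard_eq_toFinset_card', ← Finset.card_product]
      · refine Finset.card_le_card fun x hx => ?_
        obtain ⟨f, hf, hx⟩ := Finset.mem_biUnion.1 hx
        obtain ⟨hxO, hxf⟩ := (Finset.mem_filter.1 hx).2
        simp only [Finset.mem_product, Set.mem_toFinset, Finset.mem_univ, and_true]
        refine ⟨hxO, fun h => Finset.ne_of_mem_erase hf ?_⟩
        rw [← hxf]
        ext w
        exact hW _ w.2 _ (W.smul_mem _ h.1)
      · intro f _ g _ hfg
        rw [Function.onFun, Finset.disjoint_left]
        intro x hx hx'
        exact hfg ((Finset.mem_filter.1 hx).2.2.symm.trans (Finset.mem_filter.1 hx').2.2)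
    have h2 := Set.ncard_sdiff_add_ncard_of_subset (Set.inter_subset_right (s := pts W) (t := O))
      (Set.toFinite _)
    rw [hWO] at h2
    have h3 : ((O \ (pts W ∩ O)).ncard : ℝ) = O.ncard - m := by
      rw [← h2]; push_cast; ring
    calc ∑ f ∈ D, ((A f).card : ℝ) = ((∑ f ∈ D, (A f).card : ℕ) : ℝ) := by push_cast; rfl
      _ ≤ (((O \ (pts W ∩ O)).ncard * (Fintype.card F - 1) : ℕ) : ℝ) := by exact_mod_cast h1
      _ = _ := by
        rw [Nat.cast_mul, h3, Nat.cast_sub Fintype.card_pos, Nat.cast_one]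
  -- each point of `W` lies on few hyperplanes of `W`
  have hIsum : ∑ f ∈ D, (I f : ℝ) ≤ m * (q ^ n - 1) := by
    let T : Finset (Projectivization F V) := (pts W ∩ O).toFinset
    have hT : T.card = m := by rw [← hWO, Set.ncard_eq_toFinset_card']
    have hdc := Finset.sum_card_bipartiteAbove_eq_sum_card_bipartiteBelow (s := D) (t := T)
      (fun f p => p ∈ pts ((LinearMap.ker f).map W.subtype))
    have h1 : ∀ f ∈ D, I f ≤ (T.bipartiteAbove
        (fun f p => p ∈ pts ((LinearMap.ker f).map W.subtype)) f).card := by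
      intro f _
      rw [← Set.ncard_coe_finset]
      refine Set.ncard_le_ncard ?_ (Set.toFinite _)
      intro p hp
      simp only [Finset.mem_coe, Finset.mem_bipartiteAbove, T, Set.mem_toFinset]
      exact ⟨⟨Submodule.map_subtype_le _ _ hp.1, hp.2⟩, hp.1⟩
    have h2 : ∀ p ∈ T, (D.bipartiteBelow
        (fun f p => p ∈ pts ((LinearMap.ker f).map W.subtype)) p).card
          ≤ Fintype.card F ^ n - 1 := by
      intro p hp
      have hpW : p.rep ∈ W := (Set.mem_toFinset.1 hp).1
      have hx : (⟨p.rep, hpW⟩ : W) ≠ 0 := fun h => p.rep_nonzero (congrArg Subtype.val h)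
      have h3 := card_dual_apply_eq_zero_mul (F := F) hx
      rw [hdual, pow_succ] at h3
      rw [← Nat.eq_of_mul_eq_mul_right Fintype.card_pos h3,
        ← Finset.card_erase_of_mem (a := 0) (by simp)]
      refine Finset.card_le_card ?_
      intro f hf
      obtain ⟨hfD, y, hy, hyp⟩ := (Finset.mem_bipartiteBelow _).1 hf
      have : y = ⟨p.rep, hpW⟩ := Subtype.ext hyp
      subst this
      simpa [D] using ⟨Finset.ne_of_mem_erase hfD, hy⟩
    have h4 : ∑ f ∈ D, I f ≤ m * (Fintype.card F ^ n - 1) := by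
      refine (Finset.sum_le_sum h1).trans ?_
      rw [hdc]
      refine (Finset.sum_le_sum h2).trans ?_
      simp [hT]
    have h5 : 1 ≤ Fintype.card F ^ n := Nat.one_le_pow _ _ Fintype.card_pos
    calc ∑ f ∈ D, (I f : ℝ) = ((∑ f ∈ D, I f : ℕ) : ℝ) := by push_cast; rfl
      _ ≤ ((m * (Fintype.card F ^ n - 1) : ℕ) : ℝ) := by exact_mod_cast h4
      _ = _ := by rw [Nat.cast_mul, Nat.cast_sub h5]; push_cast; rfl
  have hDcard : (D.card : ℝ) = q ^ (n + 1) - 1 := by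
    rw [Finset.card_erase_of_mem (Finset.mem_univ _), Finset.card_univ, hdual,
      Nat.cast_sub (Nat.one_le_pow _ _ Fintype.card_pos)]
    push_cast; rfl
  have hmain : N * (m * q ^ n * (q - 1)) ≤ ((O.ncard - m) * (q - 1)) * q ^ n := by
    calc N * (m * q ^ n * (q - 1)) = N * (m * (q ^ (n + 1) - 1) - m * (q ^ n - 1)) := by ring
      _ ≤ N * (∑ f ∈ D, ((m : ℝ) - I f)) := by
        refine mul_le_mul_of_nonneg_left ?_ hN0
        rw [Finset.sum_sub_distrib, Finset.sum_const, nsmul_eq_mul, hDcard]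
        linarith
      _ = ∑ f ∈ D, N * ((m : ℝ) - I f) := Finset.mul_sum _ _ _
      _ ≤ ∑ f ∈ D, ((A f).card : ℝ) * q ^ n := by
        refine Finset.sum_le_sum fun f hf => ?_
        have hf0 := Finset.ne_of_mem_erase hf
        have h := card_singular_mul_le hW s hO hf0
        rw [hn, Nat.add_sub_cancel] at h
        refine (mul_le_mul_of_nonneg_right (hN f hf0) ?_).trans h
        exact sub_nonneg.2 (by exact_mod_cast hI f)
      _ ≤ _ := by
        rw [← Finset.sum_mul]
        exact mul_le_mul_of_nonneg_right hA (by positivity)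
  have hpos : 0 < q ^ n * (q - 1) := mul_pos (by positivity) (by linarith)
  have : (N * m) * (q ^ n * (q - 1)) ≤ (O.ncard - m) * (q ^ n * (q - 1)) := by
    linarith [hmain]
  have := le_of_mul_le_mul_right this hpos
  linarith

end counting

open scoped Classical in
/-- If every value of `h` on the fibre of the pairing over `f` can be moved to `0` by a
translation, then the zeros of `h` make up a large part of that fibre. -/
lemma card_le_card_mul_card_singular {F V : Type} [Field F] [Fintype F] [AddCommGroup V]
    [Module F V] [Fintype V] {σ : F →+* F} {B : V →ₗ[F] V →ₛₗ[σ] F}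
    (nondeg : ∀ v, (∀ w, B v w = 0) → v = 0) {W : Submodule F V}
    (hW : ∀ v ∈ W, ∀ w ∈ W, B v w = 0) (h : V → F) (T : Finset F) (hT : ∀ v, h v ∈ T)
    (f : Module.Dual F W)
    (htr : ∀ t ∈ T, ∃ w ∈ W, ∀ u, restrictedPairing B W u = f → h u = t → h (u + w) = 0) :
    Fintype.card V ≤ T.card *
      (Finset.univ.filter fun u => h u = 0 ∧ restrictedPairing B W u = f).card *
        Fintype.card F ^ Module.finrank F W := by
  have : Finite (Module.Dual F W) := Module.finite_of_finite F
  have : Fintype (Module.Dual F W) := Fintype.ofFinite _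
  have hdual : Fintype.card (Module.Dual F W) = Fintype.card F ^ Module.finrank F W := by
    rw [Module.card_eq_pow_finrank (K := F), Subspace.dual_finrank_eq]
  rw [← card_fiber_mul_card _ (restrictedPairing_surjective B nondeg W) f, hdual]
  refine Nat.mul_le_mul_right _ ?_
  rw [Finset.card_eq_sum_card_fiberwise (f := h) (t := T) fun v _ => hT v]
  refine Finset.sum_le_card_nsmul _ _ _ fun t ht => ?_
  obtain ⟨w, hw, htw⟩ := htr t ht
  refine Finset.card_le_card_of_injOn (· + w) ?_ (add_left_injective w).injOn
  intro u hu
  simp only [Finset.coe_filter, Finset.mem_filter, Finset.mem_univ, true_and,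
    Set.mem_ofPred_eq] at hu ⊢
  refine ⟨htw u hu.1 hu.2, ?_⟩
  rw [map_add, hu.1, add_eq_left]
  ext x
  exact hW _ x.2 _ hw

open scoped Classical in
lemma card_fixed_sq_le {F : Type} [Field F] [Fintype F] {σ : F →+* F} (hσ : σ ≠ RingHom.id F) :
    (Finset.univ.filter fun c => σ c = c).card ^ 2 ≤ Fintype.card F := by
  obtain ⟨d, hd⟩ : ∃ d, σ d ≠ d := by
    by_contra! h
    exact hσ (RingHom.ext h)
  rw [sq, ← Finset.card_product, ← Finset.card_univ]
  refine Finset.card_le_card_of_injOn (fun x => x.1 + x.2 * d) (fun _ _ => by simp) ?_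
  rintro ⟨a, b⟩ hab ⟨a', b'⟩ hab' h
  simp only [Finset.coe_product, Finset.coe_filter, Finset.mem_univ, true_and, Set.mem_prod,
    Set.mem_ofPred_eq] at hab hab' h
  have hσh := congrArg σ h
  simp only [map_add, map_mul, hab.1, hab.2, hab'.1, hab'.2] at hσh
  have hb : (b - b') * (σ d - d) = 0 := by linear_combination hσh - h
  obtain rfl : b = b' :=
    sub_eq_zero.1 ((mul_eq_zero.1 hb).resolve_right (sub_ne_zero.2 hd))
  simpa using h

lemma exists_add_map_eq {F : Type} [Field F] {σ : F →+* F} (hσ : σ ≠ RingHom.id F)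
    (hσσ : σ.comp σ = RingHom.id F) {t : F} (ht : σ t = t) : ∃ c, c + σ c = t := by
  obtain ⟨c, hc⟩ : ∃ c, c + σ c ≠ 0 := by
    by_contra! h
    refine hσ (RingHom.ext fun x => ?_)
    have h1 := h 1
    rw [map_one] at h1
    simp only [RingHom.id_apply]
    linear_combination h x - x * h1
  have hcc : σ (σ c) = c := RingHom.congr_fun hσσ c
  refine ⟨t / (c + σ c) * c, ?_⟩
  rw [map_mul, map_div₀, map_add, hcc, ht, add_comm (σ c) c]
  field_simp

/-- The common features of the three kinds of polar spaces: `h` is the form whose zeros are the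
singular vectors and `T` is a set containing its values. -/
lemma PolarKind.Spec.exists_form {F : Type} [Field F] [Fintype F] {N : ℕ} {k : PolarKind}
    {σ : F →+* F} {B : (Fin N → F) →ₗ[F] (Fin N → F) →ₛₗ[σ] F}
    {sing : Set (Projectivization F (Fin N → F))} {ti : Submodule F (Fin N → F) → Prop}
    (spec : k.Spec σ B sing ti) :
    ∃ (h : (Fin N → F) → F) (T : Finset F),
      (∀ W, ti W → ∀ v ∈ W, ∀ w ∈ W, B v w = 0) ∧
      (∀ W, ti W → ∀ H ≤ W, ∀ u, h u = 0 → (∀ x ∈ H, B x u = 0) →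
        ti (H ⊔ Submodule.span F {u})) ∧
      (∀ v, h v ∈ T) ∧ ((T.card : ℝ) ≤ (Fintype.card F : ℝ) ^ (k.e - 1)) ∧
      (∀ W, ti W → ∀ f : Module.Dual F W, f ≠ 0 → ∀ t ∈ T, ∃ w ∈ W, ∀ u,
        restrictedPairing B W u = f → h u = t → h (u + w) = 0) := by
  classical
  have exists_apply_eq : ∀ (W : Submodule F (Fin N → F)) (f : Module.Dual F W),
      f ≠ 0 → ∀ c, ∃ w, f w = c := fun W f hf c => LinearMap.surjective hf c
  cases k with
  | symplectic =>
    obtain ⟨rfl, halt, -, hti⟩ := spec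
    have hskew : ∀ v w, B v w = 0 → B w v = 0 := by
      intro v w hvw
      have := halt (v + w)
      simpa [halt, hvw] using this
    refine ⟨fun _ => 0, {0}, fun W hW => (hti W).1 hW, ?_, by simp, by simp [PolarKind.e],
      fun W _ f _ t _ => ⟨0, by simp, by simp⟩⟩
    intro W hW H hHW u _ hHu
    rw [hti]
    intro v hv w hw
    obtain ⟨x, hx, _, hy, rfl⟩ := Submodule.mem_sup.1 hv
    obtain ⟨a, rfl⟩ := Submodule.mem_span_singleton.1 hy
    obtain ⟨x', hx', _, hy', rfl⟩ := Submodule.mem_sup.1 hw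
    obtain ⟨a', rfl⟩ := Submodule.mem_span_singleton.1 hy'
    simp [(hti W).1 hW x (hHW hx) x' (hHW hx'), halt, hHu x hx, hskew _ _ (hHu x' hx')]
  | hermitian =>
    obtain ⟨hσ, hσσ, hherm, -, hti⟩ := spec
    refine ⟨fun v => B v v, Finset.univ.filter fun c => σ c = c, fun W hW => (hti W).1 hW, ?_,
      fun v => by simp [← hherm], ?_, ?_⟩
    · intro W hW H hHW u hu hHu
      rw [hti]
      intro v hv w hw
      obtain ⟨x, hx, _, hy, rfl⟩ := Submodule.mem_sup.1 hv
      obtain ⟨a, rfl⟩ := Submodule.mem_span_singleton.1 hy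
      obtain ⟨x', hx', _, hy', rfl⟩ := Submodule.mem_sup.1 hw
      obtain ⟨a', rfl⟩ := Submodule.mem_span_singleton.1 hy'
      have hux : B u x' = 0 := by rw [hherm x' u, hHu x' hx', map_zero]
      simp [(hti W).1 hW x (hHW hx) x' (hHW hx'), hu, hHu x hx, hux]
    · have h := card_fixed_sq_le hσ
      have h' : ((Finset.univ.filter fun c => σ c = c).card : ℝ) ^ 2 ≤ Fintype.card F := by
        exact_mod_cast h
      have he : PolarKind.hermitian.e - 1 = 1 / 2 := by norm_num [PolarKind.e]
      rw [he, ← Real.sqrt_eq_rpow]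
      exact Real.le_sqrt_of_sq_le h'
    · intro W hW f hf t ht
      have ht' : σ (-t) = -t := by rw [map_neg, (Finset.mem_filter.1 ht).2]
      obtain ⟨c, hc⟩ := exists_add_map_eq hσ hσσ ht'
      obtain ⟨w, hw⟩ := exists_apply_eq W f hf c
      refine ⟨w, w.2, fun u hu hut => ?_⟩
      have hwu : B w u = c := by rw [← hw, ← hu, restrictedPairing_apply]
      have huw : B u w = σ c := by rw [hherm w u, hwu]
      simp only [map_add, LinearMap.add_apply, hut, hwu, huw, (hti W).1 hW w w.2 w w.2]
      linear_combination hc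
  | elliptic =>
    obtain ⟨rfl, Q, hQ, -, hti⟩ := spec
    have hadd : ∀ v w, Q (v + w) = Q v + Q w + B v w := by
      intro v w
      rw [← hQ, QuadraticMap.polar]
      ring
    have hsymm : ∀ v w, B v w = B w v := fun v w => by
      rw [← hQ, ← hQ, QuadraticMap.polar_comm]
    have hti0 : ∀ W, ti W → ∀ v ∈ W, ∀ w ∈ W, B v w = 0 := by
      intro W hW v hv w hw
      rw [hti] at hW
      have := hadd v w
      rwa [hW _ hv, hW _ hw, hW _ (W.add_mem hv hw), zero_add, zero_add, eq_comm] at this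
    refine ⟨Q, Finset.univ, hti0, ?_, by simp, by norm_num [PolarKind.e], ?_⟩
    · intro W hW H hHW u hu hHu
      rw [hti]
      intro v hv
      obtain ⟨x, hx, _, hy, rfl⟩ := Submodule.mem_sup.1 hv
      obtain ⟨a, rfl⟩ := Submodule.mem_span_singleton.1 hy
      simp [hadd, (hti W).1 hW x (hHW hx), QuadraticMap.map_smul, hu, hHu x hx]
    · intro W hW f hf t _
      obtain ⟨w, hw⟩ := exists_apply_eq W f hf (-t)
      refine ⟨w, w.2, fun u hu hut => ?_⟩
      have hwu : B w u = -t := by rw [← hw, ← hu, restrictedPairing_apply]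
      rw [hadd, hut, (hti W).1 hW w w.2, hsymm, hwu]
      ring

lemma PolarKind.cast_vdim (k : PolarKind) (r : ℕ) :
    (k.vdim r : ℝ) = 2 * r + 2 * k.e - 2 := by
  cases k <;> simp only [PolarKind.vdim, PolarKind.e] <;> push_cast <;> ring

lemma PolarSpace.IsMOvoid.mul_le_ncard {F : Type} [Field F] [Fintype F] {r : ℕ}
    {k : PolarKind} {P : PolarSpace F r k} {m : ℕ}
    {O : Set (Projectivization F (Fin (k.vdim r) → F))} (hO : P.IsMOvoid m O) (hr : 0 < r) :
    (m : ℝ) * ((Fintype.card F : ℝ) ^ ((r : ℝ) + k.e - 1) + 1) ≤ O.ncard := by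
  classical
  obtain ⟨W, hW, hWr⟩ := P.rank_exists
  obtain ⟨h, T, hti, hext, hT, hTcard, htr⟩ := P.spec.exists_form
  have hq : (0 : ℝ) < Fintype.card F := by exact_mod_cast Fintype.card_pos
  refine mul_add_one_le_ncard (hti W hW) (fun u => h u = 0) ?_ (hO.2 W ⟨hW, hWr⟩) (hr.trans_eq hWr.symm)
    (by positivity) ?_
  · intro H hHW u hu hHu hfin
    exact hO.2 _ ⟨hext W hW H hHW u hu hHu, hfin.trans hWr⟩
  · intro f hf
    have hle := card_le_card_mul_card_singular P.nondeg (hti W hW) h T hT f (htr W hW f hf)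
    set N := (Finset.univ.filter fun u => h u = 0 ∧ restrictedPairing P.B W u = f).card
    have hV : (Fintype.card (Fin (k.vdim r) → F) : ℝ)
        = (Fintype.card F : ℝ) ^ ((r : ℝ) + k.e - 1) *
          ((Fintype.card F : ℝ) ^ (k.e - 1) * (Fintype.card F : ℝ) ^ r) := by
      rw [← Real.rpow_natCast _ r, ← Real.rpow_add hq, ← Real.rpow_add hq, Fintype.card_fun,
        Fintype.card_fin, Nat.cast_pow, ← Real.rpow_natCast, PolarKind.cast_vdim]
      congr 1
      ring
    rw [hWr] at hle
    have hle' : (Fintype.card (Fin (k.vdim r) → F) : ℝ) ≤ T.card * N * Fintype.card F ^ r := by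
      exact_mod_cast hle
    refine le_of_mul_le_mul_right (?_ : _ ≤ _ * ((Fintype.card F : ℝ) ^ (k.e - 1) *
      (Fintype.card F : ℝ) ^ r)) (by positivity)
    rw [← hV]
    calc _ ≤ (T.card : ℝ) * N * Fintype.card F ^ r := hle'
      _ ≤ (Fintype.card F : ℝ) ^ (k.e - 1) * N * Fintype.card F ^ r := by gcongr
      _ = _ := by ring

/-- Every line joining two points of `O` has weight at least `2`. -/
lemma two_mul_ncard_sub_one_le_finsum {F V : Type} [Field F] [AddCommGroup V] [Module F V]
    [Finite V] {O S : Set (Projectivization F V)} (hOS : O ⊆ S) {p₀ : Projectivization F V}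
    (hp₀ : p₀ ∈ O) :
    2 * ((O.ncard : ℝ) - 1) ≤ ∑ᶠ p ∈ S \ {p₀}, nwt O {p} *
      nwt O (pts (Submodule.span F {p₀.rep} ⊔ Submodule.span F {p.rep})) := by
  classical
  have : Fintype (Projectivization F V) := Fintype.ofFinite _
  rw [finsum_mem_eq_toFinset_sum]
  have hcard : ((O \ {p₀}).toFinset.card : ℝ) = O.ncard - 1 := by
    rw [← Set.ncard_eq_toFinset_card', eq_sub_iff_add_eq]
    exact_mod_cast Set.ncard_sdiff_singleton_add_one hp₀ (Set.toFinite _)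
  rw [← hcard, mul_comm, ← nsmul_eq_mul]
  have hsub : (O \ {p₀}).toFinset ⊆ (S \ {p₀}).toFinset :=
    Set.toFinset_subset_toFinset.2 (Set.sdiff_subset_sdiff_left hOS)
  refine (Finset.card_nsmul_le_sum _ _ 2 fun p hp => ?_).trans
    (Finset.sum_le_sum_of_subset_of_nonneg hsub fun p _ _ =>
      mul_nonneg (Nat.cast_nonneg _) (Nat.cast_nonneg _))
  obtain ⟨hpO, hpne⟩ := Set.mem_toFinset.1 hp
  have h1 : nwt O {p} = 1 := by
    rw [nwt, Set.inter_eq_left.2 (Set.singleton_subset_iff.2 hpO), Set.ncard_singleton,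
      Nat.cast_one]
  have h2 : 2 ≤ nwt O (pts (Submodule.span F {p₀.rep} ⊔ Submodule.span F {p.rep})) := by
    have h := Set.ncard_le_ncard (s := {p₀, p})
      (t := pts (Submodule.span F {p₀.rep} ⊔ Submodule.span F {p.rep}) ∩ O) ?_ (Set.toFinite _)
    · rw [Set.ncard_pair (Ne.symm hpne)] at h
      rw [nwt]
      exact_mod_cast h
    · rintro x (rfl | rfl)
      · exact ⟨Submodule.mem_sup_left (Submodule.mem_span_singleton_self _), hp₀⟩
      · exact ⟨Submodule.mem_sup_right (Submodule.mem_span_singleton_self _), hpO⟩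
  rw [h1, one_mul]
  exact h2

/-- Lemma 4.1, second part: if `O` is a non-trivial `m`-ovoid of `P'_{r,e}`
with weight function `μ` and `p₀ ∈ O`, then
`Σ_{p ∈ P'_{r,e}∖{p₀}} μ(p)·μ(⟨p₀,p⟩) ≥ 2·(m·(q^{r+e−1}+1) − 1)`. -/
theorem ovoid_line_weight_sum_lower_bound
    {F : Type} [Field F] [Fintype F] {q r m : ℕ} (hq : Fintype.card F = q)
    {k : PolarKind} (P : PolarSpace F r k)
    (O : Set (Projectivization F (Fin (k.vdim r) → F)))
    (hO : P.IsNontrivialMOvoid m O)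
    (p₀ : Projectivization F (Fin (k.vdim r) → F)) (hp₀ : p₀ ∈ O) :
    ∑ᶠ p ∈ P.sing \ {p₀},
        nwt O {p} *
          nwt O (pts (Submodule.span F {p₀.rep} ⊔ Submodule.span F {p.rep}))
      ≥ 2 * ((m : ℝ) * ((q : ℝ) ^ ((r : ℝ) + k.e - 1) + 1) - 1) := by
  subst hq
  have hr : 0 < r := by
    by_contra! h
    obtain rfl : r = 0 := by omega
    have := hO.2.2
    simp at this
  have hcard := hO.1.mul_le_ncard hr
  have hsum := two_mul_ncard_sub_one_le_finsum hO.1.1 hp₀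
  linarith

end PolarOvoids
end
end

section
/- Let O be a non-trivial m-ovoid of the polar space P'_{r,e} with m ≥ 2. Then (q−1)²·m² + 3(q−1)·m − q^{r+e−1} − q + 2 ≥ 0. -/
noncomputable section

open scoped BigOperators

namespace PolarOvoids

open Finset Classical in
/-- The sum of a nontrivial additive character of `F` along an additive map to `F` which is
either zero or onto. -/
lemma sum_addChar_comp {F A : Type} [Field F] [AddCommGroup A] [Fintype A]
    {ψ : AddChar F ℂ} (hψ : ψ ≠ 0) (L : A →+ F)
    (hL : ∀ a, L a ≠ 0 → ∀ c, ∃ b, L b = c) :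
    ∑ a, ψ (L a) = if ∀ a, L a = 0 then (Fintype.card A : ℂ) else 0 := by
  have h := AddChar.sum_eq_ite (ψ.compAddMonoidHom L)
  simp only [AddChar.compAddMonoidHom_apply] at h
  rw [h]
  congr 1
  simp only [eq_iff_iff]
  constructor
  · intro h0
    by_contra! hne
    obtain ⟨a, ha⟩ := hne
    obtain ⟨c, hc⟩ := AddChar.ne_zero_iff.1 hψ
    obtain ⟨b, rfl⟩ := hL a ha c
    exact hc (by simpa using DFunLike.congr_fun h0 b)
  · intro h0
    ext a
    simp [h0 a]

/-- There is a nontrivial complex additive character on a finite field. -/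
lemma exists_addChar_ne_zero (F : Type) [Field F] [Finite F] : ∃ ψ : AddChar F ℂ, ψ ≠ 0 := by
  obtain ⟨ψ, h⟩ := (AddChar.exists_apply_ne_zero (a := (1 : F))).2 one_ne_zero
  exact ⟨ψ, AddChar.ne_zero_iff.2 ⟨1, h⟩⟩

section PolarGeometry

variable {F V : Type} [Field F] [AddCommGroup V] [Module F V] {σ : F →+* F}
  {B : V →ₗ[F] V →ₛₗ[σ] F} {Z : Set V} {κ : ℕ}

/-- The properties shared by the sets `Z` of singular vectors of the three kinds of polar spaces:
each line through `y` in the direction of a singular vector not perpendicular to `y` contains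
exactly `κ` singular vectors. -/
structure IsPolarGeometry (B : V →ₗ[F] V →ₛₗ[σ] F) (Z : Set V) (κ : ℕ) : Prop where
  nondeg : ∀ v, (∀ w, B v w = 0) → v = 0
  refl : ∀ v w, B v w = 0 → B w v = 0
  self : ∀ v ∈ Z, B v v = 0
  zero_mem : (0 : V) ∈ Z
  smul_mem : ∀ (c : F), ∀ v ∈ Z, c • v ∈ Z
  add_mem : ∀ v ∈ Z, ∀ w ∈ Z, B v w = 0 → v + w ∈ Z
  card_line : ∀ x ∈ Z, ∀ y, B x y ≠ 0 → Nat.card {c : F // y + c • x ∈ Z} = κ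

/-- Totally isotropic subspaces consisting of singular vectors. -/
def IsTotSing (B : V →ₗ[F] V →ₛₗ[σ] F) (Z : Set V) (U : Submodule F V) : Prop :=
  (∀ v ∈ U, v ∈ Z) ∧ ∀ v ∈ U, ∀ w ∈ U, B v w = 0

lemma mem_sperp {U : Submodule F V} {v : V} : v ∈ sperp B U ↔ ∀ w ∈ U, B w v = 0 := Iff.rfl

lemma mem_sperp_sup_span {U : Submodule F V} {x v : V} :
    v ∈ sperp B (U ⊔ F ∙ x) ↔ v ∈ sperp B U ∧ B x v = 0 := by
  simp only [mem_sperp]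
  constructor
  · intro h
    exact ⟨fun w hw => h w (Submodule.mem_sup_left hw),
      h x (Submodule.mem_sup_right (Submodule.mem_span_singleton_self x))⟩
  · rintro ⟨h, hx⟩ w hw
    obtain ⟨y, hy, z, hz, rfl⟩ := Submodule.mem_sup.1 hw
    obtain ⟨c, rfl⟩ := Submodule.mem_span_singleton.1 hz
    simp [h y hy, hx]

lemma IsTotSing.le_sperp {U : Submodule F V} (hU : IsTotSing B Z U) : U ≤ sperp B U :=
  fun v hv w hw => hU.2 w hw v hv

lemma IsPolarGeometry.isTotSing_sup_span (h : IsPolarGeometry B Z κ) {U : Submodule F V}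
    (hU : IsTotSing B Z U) {x : V} (hx : x ∈ Z) (hxU : x ∈ sperp B U) :
    IsTotSing B Z (U ⊔ F ∙ x) := by
  have key : ∀ v ∈ U ⊔ F ∙ x, ∃ y ∈ U, ∃ c : F, v = y + c • x := by
    intro v hv
    obtain ⟨y, hy, z, hz, rfl⟩ := Submodule.mem_sup.1 hv
    obtain ⟨c, rfl⟩ := Submodule.mem_span_singleton.1 hz
    exact ⟨y, hy, c, rfl⟩
  constructor
  · intro v hv
    obtain ⟨y, hy, c, rfl⟩ := key v hv
    exact h.add_mem _ (hU.1 y hy) _ (h.smul_mem c x hx) (by simp [hxU y hy])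
  · intro v hv w hw
    obtain ⟨y, hy, c, rfl⟩ := key v hv
    obtain ⟨y', hy', c', rfl⟩ := key w hw
    simp [hxU y hy, h.refl _ _ (hxU y' hy'), hU.2 y hy y' hy', h.self x hx]

lemma IsPolarGeometry.isTotSing_bot (h : IsPolarGeometry B Z κ) :
    IsTotSing B Z (⊥ : Submodule F V) := by
  simp [IsTotSing, h.zero_mem]

lemma mem_sup_span_singleton {U : Submodule F V} {x v : V} :
    v ∈ U ⊔ F ∙ x ↔ ∃ c : F, v - c • x ∈ U := by
  constructor
  · intro hv
    obtain ⟨y, hy, z, hz, rfl⟩ := Submodule.mem_sup.1 hv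
    obtain ⟨c, rfl⟩ := Submodule.mem_span_singleton.1 hz
    exact ⟨c, by simpa using hy⟩
  · rintro ⟨c, hc⟩
    exact Submodule.mem_sup.2 ⟨_, hc, _, Submodule.mem_span_singleton.2 ⟨c, rfl⟩, by simp⟩

/-- The exchange property. -/
lemma mem_sup_span_comm {U : Submodule F V} {x y : V} (hx : x ∉ U)
    (h : x ∈ U ⊔ F ∙ y) : y ∈ U ⊔ F ∙ x ∧ y ∉ U := by
  obtain ⟨c, hc⟩ := mem_sup_span_singleton.1 h
  have hc0 : c ≠ 0 := by
    rintro rfl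
    simp at hc
    exact hx hc
  constructor
  · refine mem_sup_span_singleton.2 ⟨c⁻¹, ?_⟩
    have := U.smul_mem (-c⁻¹) hc
    rwa [smul_sub, smul_smul, neg_mul, inv_mul_cancel₀ hc0, neg_smul, neg_smul, one_smul,
      sub_neg_eq_add, neg_add_eq_sub] at this
  · intro hy
    exact hx (by simpa using U.add_mem hc (U.smul_mem c hy))

variable [Fintype V]

lemma natCard_submodule_pos (U : Submodule F V) : (0 : ℝ) < Nat.card U := by
  exact_mod_cast Nat.card_pos

lemma IsPolarGeometry.mem_of_maximal (h : IsPolarGeometry B Z κ) {r : ℕ}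
    (hle : ∀ U, IsTotSing B Z U → Module.finrank F U ≤ r) {W : Submodule F V}
    (hW : IsTotSing B Z W) (hWr : Module.finrank F W = r) {z : V} (hz : z ∈ Z)
    (hzW : z ∈ sperp B W) : z ∈ W := by
  by_contra hzn
  have := hle _ (h.isTotSing_sup_span hW hz hzW)
  rw [Submodule.finrank_sup_span_singleton hzn] at this
  omega

open Finset Classical in
lemma card_filter_mem_submodule (U : Submodule F V) : #{z | z ∈ U} = Nat.card U := by
  rw [Nat.card_eq_fintype_card, Fintype.card_subtype]

variable [Fintype F]

lemma card_submodule_eq_pow (U : Submodule F V) :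
    Nat.card U = Fintype.card F ^ Module.finrank F U := by
  rw [Module.natCard_eq_pow_finrank (K := F), Nat.card_eq_fintype_card]

lemma card_sup_span {U : Submodule F V} {x : V} (hx : x ∉ U) :
    Nat.card ↥(U ⊔ F ∙ x) = Fintype.card F * Nat.card U := by
  rw [card_submodule_eq_pow, card_submodule_eq_pow, Submodule.finrank_sup_span_singleton hx]
  ring

open Finset Classical in
lemma sum_char_right {ψ : AddChar F ℂ} (hψ : ψ ≠ 0)
    (hB : ∀ v, (∀ w, B v w = 0) → v = 0) (v : V) :
    ∑ w, ψ (B v w) = if v = 0 then (Fintype.card V : ℂ) else 0 := by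
  have := sum_addChar_comp hψ (B v).toAddMonoidHom (by
    intro w hw c
    have hσ : Function.Surjective σ := Finite.surjective_of_injective σ.injective
    obtain ⟨d, hd⟩ := hσ (c * (B v w)⁻¹)
    refine ⟨d • w, ?_⟩
    simp at hw
    simp [hd, hw])
  simp only [LinearMap.toAddMonoidHom_coe] at this
  rw [this]
  congr 1
  simp only [eq_iff_iff]
  exact ⟨hB v, by rintro rfl; simp⟩

open Finset Classical in
lemma IsPolarGeometry.card_mul_card_sperp (h : IsPolarGeometry B Z κ) (U : Submodule F V) :
    Nat.card U * Nat.card (sperp B U) = Fintype.card V := by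
  obtain ⟨ψ, hψ⟩ := exists_addChar_ne_zero F
  have h1 : ∑ v : U, ∑ w : V, ψ (B v w) = (Fintype.card V : ℂ) := by
    simp [sum_char_right hψ h.nondeg]
  have h2 : ∀ w : V, ∑ v : U, ψ (B v w) = if w ∈ sperp B U then (Nat.card U : ℂ) else 0 := by
    intro w
    have := sum_addChar_comp hψ (((B.flip w).comp U.subtype).toAddMonoidHom) (by
      intro v hv c
      refine ⟨(c * (B v w)⁻¹) • v, ?_⟩
      simp at hv
      simp [hv])
    simp only [LinearMap.toAddMonoidHom_coe, LinearMap.comp_apply, LinearMap.flip_apply,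
      Submodule.subtype_apply] at this
    rw [this, Nat.card_eq_fintype_card]
    simp [mem_sperp]
  rw [sum_comm] at h1
  simp only [h2] at h1
  rw [← sum_filter, sum_const, nsmul_eq_mul] at h1
  have h3 : Nat.card (sperp B U) = #{w | w ∈ sperp B U} := by
    rw [Nat.card_eq_fintype_card, Fintype.card_subtype]
  rw [h3, mul_comm]
  exact_mod_cast h1

open Finset Classical in
/-- Counting singular vectors in the perp of `U ⊔ F ∙ x`. -/
lemma IsPolarGeometry.card_sing_step (h : IsPolarGeometry B Z κ) {U : Submodule F V}
    {x : V} (hx : x ∈ Z) (hxU : x ∈ sperp B U) :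
    Fintype.card F * #{z | z ∈ Z ∧ z ∈ sperp B U} + κ * Nat.card (sperp B (U ⊔ F ∙ x)) =
    Fintype.card F * #{z | z ∈ Z ∧ z ∈ sperp B (U ⊔ F ∙ x)} + κ * Nat.card (sperp B U) := by
  have e1 : #{z | z ∈ Z ∧ z ∈ sperp B U} = #{z | z ∈ Z ∧ z ∈ sperp B (U ⊔ F ∙ x)}
      + #{z | z ∈ Z ∧ z ∈ sperp B U ∧ B x z ≠ 0} := by
    rw [← card_filter_add_card_filter_not (fun z => B x z = 0)]
    simp only [filter_filter, mem_sperp_sup_span, and_assoc, ne_eq]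
  have e2 : Nat.card (sperp B U) = Nat.card (sperp B (U ⊔ F ∙ x))
      + #{z | z ∈ sperp B U ∧ B x z ≠ 0} := by
    rw [Nat.card_eq_fintype_card, Nat.card_eq_fintype_card, Fintype.card_subtype,
      Fintype.card_subtype, ← card_filter_add_card_filter_not (fun z => B x z = 0)]
    simp only [filter_filter, mem_sperp_sup_span, ne_eq]
  have e3 : Fintype.card F * #{z | z ∈ Z ∧ z ∈ sperp B U ∧ B x z ≠ 0}
      = κ * #{z | z ∈ sperp B U ∧ B x z ≠ 0} := by
    have l : ∑ y with y ∈ sperp B U ∧ B x y ≠ 0, #{c : F | y + c • x ∈ Z}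
        = κ * #{z | z ∈ sperp B U ∧ B x z ≠ 0} := by
      rw [sum_const_nat (m := κ), mul_comm]
      intro y hy
      rw [← h.card_line x hx y (mem_filter.1 hy).2.2, Nat.card_eq_fintype_card,
        Fintype.card_subtype]
    rw [← l]
    simp only [card_filter]
    rw [sum_comm]
    simp only [← card_filter]
    rw [sum_const_nat (m := #{z | z ∈ Z ∧ z ∈ sperp B U ∧ B x z ≠ 0})]
    · simp
    intro c _
    rw [filter_filter]
    refine card_bij (fun y _ => y + c • x) ?_ ?_ ?_
    · intro y hy
      simp only [mem_filter, mem_univ, true_and] at hy ⊢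
      exact ⟨hy.2, (sperp B U).add_mem hy.1.1 ((sperp B U).smul_mem c hxU),
        by simpa [h.self x hx] using hy.1.2⟩
    · intro a _ b _ hab
      simpa using hab
    · intro z hz
      simp only [mem_filter, mem_univ, true_and] at hz
      refine ⟨z - c • x, ?_, by simp⟩
      simp only [mem_filter, mem_univ, true_and]
      exact ⟨⟨(sperp B U).sub_mem hz.2.1 ((sperp B U).smul_mem c hxU),
        by simpa [h.self x hx] using hz.2.2⟩, by simpa using hz.1⟩
  rw [e1, e2]
  linarith

lemma IsPolarGeometry.card_sperp_eq_div (h : IsPolarGeometry B Z κ) {u : ℝ}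
    (hu : u ^ 2 = Fintype.card V) (U : Submodule F V) :
    (Nat.card (sperp B U) : ℝ) = u ^ 2 / Nat.card U := by
  rw [eq_div_iff (natCard_submodule_pos U).ne', hu, mul_comm]
  exact_mod_cast h.card_mul_card_sperp U

open Finset Classical in
lemma IsPolarGeometry.card_sing_sub_const (h : IsPolarGeometry B Z κ) {u : ℝ} {r : ℕ}
    (hu : u ^ 2 = Fintype.card V) (hκ : κ * u = (Fintype.card F : ℝ) ^ (r + 1))
    {U : Submodule F V} (hU : IsTotSing B Z U) :
    (#{z | z ∈ Z ∧ z ∈ sperp B U} : ℝ) - u * (Fintype.card F : ℝ) ^ r / Nat.card U =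
      #{z | z ∈ Z ∧ z ∈ sperp B (⊥ : Submodule F V)} - u * (Fintype.card F : ℝ) ^ r := by
  have key : ∀ s : Finset V, IsTotSing B Z (Submodule.span F (s : Set V)) →
      (#{z | z ∈ Z ∧ z ∈ sperp B (Submodule.span F (s : Set V))} : ℝ)
        - u * (Fintype.card F : ℝ) ^ r / Nat.card (Submodule.span F (s : Set V)) =
      #{z | z ∈ Z ∧ z ∈ sperp B (⊥ : Submodule F V)} - u * (Fintype.card F : ℝ) ^ r := by
    intro s
    induction s using Finset.induction_on with
    | empty => simp
    | insert x s _ ih =>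
      rw [coe_insert, Submodule.span_insert, sup_comm]
      intro hs
      set U := Submodule.span F (s : Set V)
      have hU : IsTotSing B Z U :=
        ⟨fun v hv => hs.1 v (Submodule.mem_sup_left hv),
          fun v hv w hw => hs.2 v (Submodule.mem_sup_left hv) w (Submodule.mem_sup_left hw)⟩
      rw [← ih hU]
      by_cases hxU : x ∈ U
      · rw [sup_eq_left.2 (by simpa using hxU)]
      have hxs : x ∈ U ⊔ F ∙ x :=
        Submodule.mem_sup_right (Submodule.mem_span_singleton_self x)
      have hstep := h.card_sing_step (U := U) (hs.1 x hxs)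
        (fun w hw => hs.2 w (Submodule.mem_sup_left hw) x hxs)
      have hstep' : (Fintype.card F : ℝ) * #{z | z ∈ Z ∧ z ∈ sperp B U}
          + κ * Nat.card (sperp B (U ⊔ F ∙ x)) =
          Fintype.card F * #{z | z ∈ Z ∧ z ∈ sperp B (U ⊔ F ∙ x)}
          + κ * Nat.card (sperp B U) := by exact_mod_cast hstep
      rw [h.card_sperp_eq_div hu, h.card_sperp_eq_div hu, card_sup_span hxU] at hstep'
      rw [card_sup_span hxU]
      have hc := natCard_submodule_pos U
      have hq : (0 : ℝ) < Fintype.card F := by exact_mod_cast Fintype.card_pos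
      push_cast at hstep' ⊢
      generalize (#{z | z ∈ Z ∧ z ∈ sperp B U} : ℝ) = S at *
      generalize (#{z | z ∈ Z ∧ z ∈ sperp B (U ⊔ F ∙ x)} : ℝ) = S' at *
      generalize (Nat.card U : ℝ) = c at *
      generalize (Fintype.card F : ℝ) = q at *
      have h1 : κ * (u ^ 2 / (q * c)) = u * q ^ r / c := by
        rw [show κ * (u ^ 2 / (q * c)) = (κ * u) * u / (q * c) by ring, hκ]
        field_simp
        ring
      have h2 : κ * (u ^ 2 / c) = q * (u * q ^ r / c) := by
        rw [show κ * (u ^ 2 / c) = (κ * u) * u / c by ring, hκ]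
        ring
      have h3 : u * q ^ r / c = q * (u * q ^ r / (q * c)) := by
        field_simp
      rw [h1, h2] at hstep'
      apply mul_left_cancel₀ hq.ne'
      linarith
  have hspan : Submodule.span F (((U : Set V).toFinset : Finset V) : Set V) = U := by simp
  have := key (U : Set V).toFinset
  rw [hspan] at this
  exact this hU

open Finset Classical in
/-- The number of singular vectors perpendicular to a totally singular subspace. -/
lemma IsPolarGeometry.card_sing_sperp (h : IsPolarGeometry B Z κ) {u : ℝ} {r : ℕ}
    (hu : u ^ 2 = Fintype.card V) (hκ : κ * u = (Fintype.card F : ℝ) ^ (r + 1))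
    (hle : ∀ U, IsTotSing B Z U → Module.finrank F U ≤ r)
    (hex : ∃ U, IsTotSing B Z U ∧ Module.finrank F U = r)
    {U : Submodule F V} (hU : IsTotSing B Z U) :
    (#{z | z ∈ Z ∧ z ∈ sperp B U} : ℝ) =
      (Fintype.card F : ℝ) ^ r + u * ((Fintype.card F : ℝ) ^ r / Nat.card U - 1) := by
  obtain ⟨W, hW, hWr⟩ := hex
  have hS : (#{z | z ∈ Z ∧ z ∈ sperp B W} : ℝ) = (Fintype.card F : ℝ) ^ r := by
    have : (Finset.univ.filter fun z => z ∈ Z ∧ z ∈ sperp B W)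
        = Finset.univ.filter fun z => z ∈ W := by
      ext z
      simp only [mem_filter, mem_univ, true_and]
      exact ⟨fun hz => h.mem_of_maximal hle hW hWr hz.1 hz.2,
        fun hz => ⟨hW.1 z hz, hW.le_sperp hz⟩⟩
    rw [this, card_filter_mem_submodule, card_submodule_eq_pow, hWr]
    push_cast
    rfl
  have h1 := h.card_sing_sub_const hu hκ hW
  have h2 := h.card_sing_sub_const hu hκ hU
  rw [hS, card_submodule_eq_pow, hWr] at h1
  have hq : (0 : ℝ) < (Fintype.card F : ℝ) ^ r := by
    have : (0 : ℝ) < Fintype.card F := by exact_mod_cast Fintype.card_pos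
    positivity
  push_cast at h1
  rw [mul_div_assoc, div_self hq.ne'] at h1
  rw [mul_div_assoc] at h2
  linarith

open Finset Classical in
/-- A weight function supported on the singular vectors, with constant total weight on the
generators, has prescribed weight on the perp of each totally singular subspace. -/
lemma IsPolarGeometry.sum_sperp (h : IsPolarGeometry B Z κ) {u N : ℝ} {r : ℕ} (hu0 : 0 < u)
    (hu : u ^ 2 = Fintype.card V) (hκ : κ * u = (Fintype.card F : ℝ) ^ (r + 1))
    (hle : ∀ U, IsTotSing B Z U → Module.finrank F U ≤ r)
    (hex : ∃ U, IsTotSing B Z U ∧ Module.finrank F U = r)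
    {f : V → ℝ} (hfZ : ∀ x, x ∉ Z → f x = 0)
    (hf : ∀ U, IsTotSing B Z U → Module.finrank F U = r → ∑ x with x ∈ U, f x = N)
    (n : ℕ) {U : Submodule F V} (hU : IsTotSing B Z U) (hn : Module.finrank F U + n = r) :
    ∑ x with x ∈ sperp B U, f x
      = N * (u / Nat.card U + 1) - u / Nat.card U * ∑ x with x ∈ U, f x := by
  induction n generalizing U with
  | zero =>
    have : ∑ x with x ∈ sperp B U, f x = ∑ x with x ∈ U, f x := by
      symm
      apply sum_subset
      · intro x hx
        simpa using hU.le_sperp (by simpa using hx)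
      · intro x hx hxU
        apply hfZ
        intro hxZ
        exact hxU (by simpa using h.mem_of_maximal hle hU hn hxZ (by simpa using hx))
    rw [this, hf U hU hn]
    ring
  | succ n ih =>
    set q : ℝ := ((Fintype.card F : ℕ) : ℝ) with hqdef
    set c : ℝ := ((Nat.card U : ℕ) : ℝ) with hcdef
    have hq1 : 1 < q := by
      rw [hqdef]
      exact_mod_cast Fintype.one_lt_card
    have hq0 : 0 < q := by linarith
    have hc : 0 < c := natCard_submodule_pos U
    set X := ∑ x with x ∈ sperp B U ∧ x ∉ U, f x with hX
    set Y := ∑ x with x ∈ U, f x with hY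
    have hXY : ∑ x with x ∈ sperp B U, f x = Y + X := by
      rw [← sum_filter_add_sum_filter_not _ (fun x => x ∈ U), filter_filter, filter_filter]
      congr 1
      apply sum_congr _ fun _ _ => rfl
      ext x
      simpa using fun hx => hU.le_sperp hx
    set T : Finset V := {y | (y ∈ Z ∧ y ∈ sperp B U) ∧ y ∉ U} with hT
    -- the number of singular vectors outside `U` perpendicular to a larger subspace
    have hcard : ∀ U', IsTotSing B Z U' → U ≤ U' →
        (#{y | (y ∈ Z ∧ y ∈ sperp B U') ∧ y ∉ U} : ℝ) = q ^ r + u * (q ^ r / Nat.card U' - 1) - c := by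
      intro U' hU' hle'
      have h1 := h.card_sing_sperp hu hκ hle hex hU'
      rw [← card_filter_add_card_filter_not (fun x => x ∈ U), filter_filter, filter_filter] at h1
      have h2 : #{y | (y ∈ Z ∧ y ∈ sperp B U') ∧ y ∈ U} = Nat.card U := by
        rw [← card_filter_mem_submodule]
        congr 1
        ext y
        simpa using fun hy => ⟨hU.1 y hy, hU'.le_sperp (hle' hy)⟩
      rw [h2] at h1
      push_cast at h1
      linarith
    have hTc : (#T : ℝ) = q ^ r + u * (q ^ r / c - 1) - c := hcard U hU le_rfl
    have hUy : ∀ y ∈ T, IsTotSing B Z (U ⊔ F ∙ y) ∧ Module.finrank F ↥(U ⊔ F ∙ y) + n = r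
        ∧ (Nat.card ↥(U ⊔ F ∙ y) : ℝ) = q * c := by
      intro y hy
      simp only [hT, mem_filter, mem_univ, true_and] at hy
      refine ⟨h.isTotSing_sup_span hU hy.1.1 hy.1.2, ?_, ?_⟩
      · rw [Submodule.finrank_sup_span_singleton hy.2]
        omega
      · rw [card_sup_span hy.2]
        push_cast
        rfl
    set Q := u / (q * c) with hQ
    have hmain : ∑ y ∈ T, ∑ x with x ∈ sperp B (U ⊔ F ∙ y), f x
        = ∑ y ∈ T, (N * (Q + 1) - Q * ∑ x with x ∈ U ⊔ F ∙ y, f x) := by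
      apply sum_congr rfl
      intro y hy
      obtain ⟨h1, h2, h3⟩ := hUy y hy
      rw [ih h1 h2, h3]
    have hL : ∑ y ∈ T, ∑ x with x ∈ sperp B (U ⊔ F ∙ y), f x
        = #T * Y + (q ^ r + u * (q ^ r / (q * c) - 1) - c) * X := by
      simp only [mem_sperp_sup_span]
      have : ∀ y ∈ T, ∑ x with x ∈ sperp B U ∧ B y x = 0, f x
          = Y + ∑ x with x ∈ sperp B U ∧ x ∉ U, if B y x = 0 then f x else 0 := by
        intro y hy
        simp only [hT, mem_filter, mem_univ, true_and] at hy
        rw [← sum_filter_add_sum_filter_not _ (fun x => x ∈ U), filter_filter, filter_filter,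
          ← sum_filter, filter_filter]
        congr 1
        · apply sum_congr _ fun _ _ => rfl
          ext x
          simpa using fun hx => ⟨hU.le_sperp hx, h.refl _ _ (hy.1.2 x hx)⟩
        · apply sum_congr _ fun _ _ => rfl
          ext x
          simp only [mem_filter, mem_univ, true_and]
          tauto
      rw [sum_congr rfl this, sum_add_distrib, sum_const, nsmul_eq_mul, sum_comm]
      congr 1
      rw [hX, mul_sum]
      apply sum_congr rfl
      intro x hx
      simp only [mem_filter, mem_univ, true_and] at hx
      by_cases hxZ : x ∈ Z
      · have hc' : (Nat.card ↥(U ⊔ F ∙ x) : ℝ) = q * c := by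
          rw [card_sup_span hx.2]
          push_cast
          rfl
        rw [← sum_filter, sum_const, nsmul_eq_mul, ← hc',
          ← hcard _ (h.isTotSing_sup_span hU hxZ hx.1) le_sup_left]
        congr 3
        rw [hT, filter_filter]
        ext y
        simp only [mem_filter, mem_univ, true_and, mem_sperp_sup_span]
        have : B y x = 0 ↔ B x y = 0 := ⟨h.refl _ _, h.refl _ _⟩
        tauto
      · simp [hfZ x hxZ]
    have hR : ∑ y ∈ T, ∑ x with x ∈ U ⊔ F ∙ y, f x = #T * Y + (q * c - c) * X := by
      have : ∀ y ∈ T, ∑ x with x ∈ U ⊔ F ∙ y, f x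
          = Y + ∑ x with x ∈ sperp B U ∧ x ∉ U, if x ∈ U ⊔ F ∙ y then f x else 0 := by
        intro y hy
        have hTS := (hUy y hy).1
        rw [← sum_filter_add_sum_filter_not _ (fun x => x ∈ U), filter_filter, filter_filter,
          ← sum_filter, filter_filter]
        congr 1
        · apply sum_congr _ fun _ _ => rfl
          ext x
          simpa using fun hx => Submodule.mem_sup_left hx
        · apply sum_congr _ fun _ _ => rfl
          ext x
          simp only [mem_filter, mem_univ, true_and]
          have : x ∈ U ⊔ F ∙ y → x ∈ sperp B U := fun hx =>
            (mem_sperp_sup_span.1 (hTS.le_sperp hx)).1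
          tauto
      rw [sum_congr rfl this, sum_add_distrib, sum_const, nsmul_eq_mul, sum_comm]
      congr 1
      rw [hX, mul_sum]
      apply sum_congr rfl
      intro x hx
      simp only [mem_filter, mem_univ, true_and] at hx
      by_cases hxZ : x ∈ Z
      · rw [← sum_filter, sum_const, nsmul_eq_mul]
        congr 1
        have hTS := h.isTotSing_sup_span hU hxZ hx.1
        have e : T.filter (fun y => x ∈ U ⊔ F ∙ y)
            = Finset.univ.filter fun y => y ∈ U ⊔ F ∙ x ∧ y ∉ U := by
          rw [hT, filter_filter]
          ext y
          simp only [mem_filter, mem_univ, true_and]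
          constructor
          · rintro ⟨-, hxy⟩
            exact mem_sup_span_comm hx.2 hxy
          · rintro ⟨h1, h2⟩
            exact ⟨⟨⟨hTS.1 y h1, (mem_sperp_sup_span.1 (hTS.le_sperp h1)).1⟩, h2⟩,
              (mem_sup_span_comm h2 h1).1⟩
        rw [e]
        have e2 := card_filter_mem_submodule (U ⊔ F ∙ x)
        rw [← card_filter_add_card_filter_not (fun x => x ∈ U), filter_filter, filter_filter,
          card_sup_span hx.2] at e2
        have e3 : #{y | y ∈ U ⊔ F ∙ x ∧ y ∈ U} = Nat.card U := by
          rw [← card_filter_mem_submodule]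
          congr 1
          ext y
          simpa using fun hy => Submodule.mem_sup_left hy
        rw [e3] at e2
        have e4 : c + (#{y | y ∈ U ⊔ F ∙ x ∧ y ∉ U} : ℝ) = q * c := by
          rw [hcdef, hqdef]
          exact_mod_cast e2
        linarith
      · simp [hfZ x hxZ]
    rw [sum_sub_distrib, sum_const, nsmul_eq_mul, ← mul_sum, hL, hR, hTc] at hmain
    rw [hXY]
    have hfin : Module.finrank F U + 1 ≤ r := by omega
    have hcq : c = q ^ Module.finrank F U := by
      rw [hcdef, card_submodule_eq_pow]
      push_cast
      rfl
    obtain ⟨b, hb1, hb⟩ : ∃ b : ℝ, 1 ≤ b ∧ q ^ r = c * q * b := by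
      refine ⟨q ^ n, one_le_pow₀ hq1.le, ?_⟩
      rw [hcq, ← hn]
      ring
    have huQ : u = Q * (q * c) := by
      rw [hQ]
      field_simp
    have hQ0 : 0 < Q := by positivity
    rw [hb] at hmain
    have d1 : c * q * b / c = q * b := by field_simp
    have d2 : c * q * b / (q * c) = b := by field_simp
    rw [d1, d2, huQ] at hmain
    have d3 : u / c = Q * q := by
      rw [huQ]
      field_simp
    rw [d3]
    have hqb : 0 < q * b - 1 := by nlinarith
    have hpos : 0 < c * (q * b - 1) * (1 + Q) := by positivity
    apply mul_left_cancel₀ hpos.ne'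
    linear_combination hmain

open Finset Classical in
/-- The Fourier transform of a cone `D`, expressed through hyperplane intersections. -/
lemma sum_char_cone {ψ : AddChar F ℂ} (hψ : ψ ≠ 0) {D : Finset V}
    (hsmul : ∀ d ∈ D, ∀ c : F, c ≠ 0 → c • d ∈ D) (w : V) :
    ∑ d ∈ D, ψ (B d w)
      = ((((Fintype.card F : ℝ) * #{d ∈ D | B d w = 0} - #D) / (Fintype.card F - 1) : ℝ) : ℂ) := by
  have hq1 : (1 : ℝ) < Fintype.card F := by exact_mod_cast Fintype.one_lt_card
  have h1 : ∑ c : F, ∑ d ∈ D, ψ (B (c • d) w) = (Fintype.card F : ℂ) * #{d ∈ D | B d w = 0} := by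
    rw [sum_comm]
    have : ∀ d ∈ D, ∑ c : F, ψ (B (c • d) w)
        = if B d w = 0 then (Fintype.card F : ℂ) else 0 := by
      intro d _
      have := sum_addChar_comp hψ (((B.flip w).comp (LinearMap.toSpanSingleton F V d)).toAddMonoidHom) (by
        intro c hc e
        refine ⟨e * (B d w)⁻¹, ?_⟩
        simp at hc
        simp [hc])
      simp only [LinearMap.toAddMonoidHom_coe, LinearMap.comp_apply, LinearMap.flip_apply,
        LinearMap.toSpanSingleton_apply] at this
      rw [this]
      congr 1
      simp only [map_smul, LinearMap.smul_apply, smul_eq_mul, mul_eq_zero, eq_iff_iff]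
      exact ⟨fun h => (h 1).resolve_left one_ne_zero, fun h a => Or.inr h⟩
    rw [sum_congr rfl this, ← sum_filter, sum_const, nsmul_eq_mul, mul_comm]
  have h2 : ∀ c : F, c ≠ 0 → ∑ d ∈ D, ψ (B (c • d) w) = ∑ d ∈ D, ψ (B d w) := by
    intro c hc
    refine sum_bij (fun d _ => c • d) (fun d hd => hsmul d hd c hc) ?_ ?_ (fun _ _ => rfl)
    · intro a _ b _ hab
      exact smul_right_injective V hc hab
    · intro b hb
      exact ⟨c⁻¹ • b, hsmul b hb _ (inv_ne_zero hc), by simp [smul_smul, hc]⟩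
  rw [← add_sum_erase _ _ (mem_univ (0 : F)),
    sum_congr rfl (fun c hc => h2 c (ne_of_mem_erase hc))] at h1
  simp only [zero_smul, map_zero, LinearMap.zero_apply, AddChar.map_zero_eq_one, sum_const,
    card_erase_of_mem (mem_univ _), card_univ, nsmul_eq_mul, mul_one] at h1
  rw [Nat.cast_sub Fintype.card_pos] at h1
  have hq1' : ((Fintype.card F : ℂ) - 1) ≠ 0 := by
    have : ((Fintype.card F : ℝ) - 1) ≠ 0 := by linarith
    exact_mod_cast this
  push_cast at h1 ⊢
  rw [eq_div_iff hq1']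
  linear_combination h1

open Finset Classical in
/-- A cone of size `N * (u + 1)` meeting each generator in `N` vectors, where `u` is the square
root of the size of the space, satisfies a quadratic inequality. -/
theorem IsPolarGeometry.quadratic_inequality (h : IsPolarGeometry B Z κ) {u N : ℝ} {r : ℕ}
    (hu0 : 0 < u) (hu : u ^ 2 = Fintype.card V)
    (hκ : κ * u = (Fintype.card F : ℝ) ^ (r + 1))
    (hle : ∀ U, IsTotSing B Z U → Module.finrank F U ≤ r)
    (hex : ∃ U, IsTotSing B Z U ∧ Module.finrank F U = r)
    {D : Finset V} (hDZ : ∀ d ∈ D, d ∈ Z) (hD0 : (0 : V) ∉ D)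
    (hsmul : ∀ d ∈ D, ∀ c : F, c ≠ 0 → c • d ∈ D) (hDne : D.Nonempty)
    (hgen : ∀ U, IsTotSing B Z U → Module.finrank F U = r → (#{d ∈ D | d ∈ U} : ℝ) = N) :
    0 ≤ N ^ 2 + 3 * N - u - Fintype.card F + 2 := by
  obtain ⟨ψ, hψ⟩ := exists_addChar_ne_zero F
  have hq1 : (1 : ℝ) < Fintype.card F := by exact_mod_cast Fintype.one_lt_card
  set q : ℝ := ((Fintype.card F : ℕ) : ℝ) with hq
  have hq0 : 0 < q := by linarith
  have hq1' : q - 1 ≠ 0 := by linarith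
  have hf : ∀ U : Submodule F V, ∑ x with x ∈ U, (if x ∈ D then (1 : ℝ) else 0)
      = #{d ∈ D | d ∈ U} := by
    intro U
    rw [← sum_filter, filter_filter, sum_const, nsmul_eq_mul, mul_one]
    congr 2
    ext x
    simp [and_comm]
  have hsum := fun n U hU hn => h.sum_sperp hu0 hu hκ hle hex
    (f := fun x => if x ∈ D then (1 : ℝ) else 0) (N := N)
    (fun x hx => if_neg fun hD => hx (hDZ x hD))
    (fun U hU hr => by rw [hf]; exact hgen U hU hr) n (U := U) hU hn
  simp only [hf] at hsum
  -- the size of `D`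
  have hDcard : (#D : ℝ) = N * (u + 1) := by
    have := hsum r ⊥ h.isTotSing_bot (by simp)
    have e1 : D.filter (fun d => d ∈ sperp B (⊥ : Submodule F V)) = D :=
      filter_true_of_mem fun d _ => by simp [mem_sperp]
    have e2 : D.filter (fun d => d ∈ (⊥ : Submodule F V)) = ∅ :=
      filter_false_of_mem fun d hd h0 => hD0 (by rwa [(Submodule.mem_bot F).1 h0] at hd)
    rw [e1, e2] at this
    simpa using this
  set G : V → ℝ := fun w => (q * #{d ∈ D | B d w = 0} - #D) / (q - 1) with hG
  have hGψ : ∀ w, ∑ d ∈ D, ψ (B d w) = (G w : ℂ) := sum_char_cone hψ hsmul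
  have hG0 : G 0 = N * (u + 1) := by
    simp only [hG, map_zero, filter_true, hDcard]
    field_simp
  have hGZ : ∀ w ∈ Z, w ≠ 0 → G w = N - if w ∈ D then u else 0 := by
    intro w hw hw0
    have hTS : IsTotSing B Z (F ∙ w) := by
      have := h.isTotSing_sup_span h.isTotSing_bot hw (by simp [mem_sperp])
      rwa [bot_sup_eq] at this
    have hr := hle _ hTS
    have hfr := finrank_span_singleton (K := F) hw0
    have hc : (Nat.card (F ∙ w) : ℝ) = q := by
      rw [card_submodule_eq_pow, hfr, pow_one]
    have := hsum (r - 1) _ hTS (by omega)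
    rw [hc] at this
    have e1 : D.filter (fun d => d ∈ sperp B (F ∙ w)) = D.filter (fun d => B d w = 0) := by
      apply filter_congr
      intro d _
      have := mem_sperp_sup_span (B := B) (U := ⊥) (x := w) (v := d)
      rw [bot_sup_eq] at this
      rw [this]
      exact ⟨fun h' => h.refl _ _ h'.2, fun h' => ⟨by simp [mem_sperp], h.refl _ _ h'⟩⟩
    have e2 : (#{d ∈ D | d ∈ F ∙ w} : ℝ) = if w ∈ D then q - 1 else 0 := by
      split_ifs with hwD
      · have : D.filter (fun d => d ∈ F ∙ w)
            = (Finset.univ.filter fun d => d ∈ F ∙ w).erase 0 := by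
          ext d
          simp only [mem_filter, mem_erase, mem_univ, true_and]
          constructor
          · rintro ⟨h1, h2⟩
            exact ⟨fun h0 => hD0 (h0 ▸ h1), h2⟩
          · rintro ⟨h1, h2⟩
            refine ⟨?_, h2⟩
            obtain ⟨c, rfl⟩ := Submodule.mem_span_singleton.1 h2
            exact hsmul w hwD c fun hc => h1 (by simp [hc])
        rw [this, card_erase_of_mem (by simp), card_filter_mem_submodule,
          Nat.cast_sub Nat.card_pos, hc, Nat.cast_one]
      · rw [filter_false_of_mem, card_empty, Nat.cast_zero]
        intro d hd h2
        obtain ⟨c, rfl⟩ := Submodule.mem_span_singleton.1 h2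
        have hc : c ≠ 0 := by
          rintro rfl
          exact hD0 (by simpa using hd)
        exact hwD (by simpa [smul_smul, hc] using hsmul _ hd c⁻¹ (inv_ne_zero hc))
    rw [e1, e2] at this
    simp only [hG]
    rw [this, hDcard]
    split_ifs
    · field_simp
      ring
    · field_simp
      ring
  -- the first moment
  have hS1 : ∑ w, G w = 0 := by
    have : ∑ w, ∑ d ∈ D, ψ (B d w) = 0 := by
      rw [sum_comm]
      apply sum_eq_zero
      intro d hd
      rw [sum_char_right hψ h.nondeg, if_neg]
      rintro rfl
      exact hD0 hd
    simp only [hGψ] at this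
    exact_mod_cast this
  have hneg : ∀ d ∈ D, -d ∈ D := fun d hd => by
    simpa using hsmul d hd (-1) (by simp)
  -- the second moment
  have hS2 : ∑ w, G w ^ 2 = u ^ 2 * #D := by
    have : ∑ w, (∑ d ∈ D, ψ (B d w)) ^ 2 = (Fintype.card V : ℂ) * #D := by
      simp only [sq, sum_mul_sum, ← AddChar.map_add_eq_mul, ← LinearMap.add_apply, ← map_add]
      rw [sum_comm, mul_comm, ← nsmul_eq_mul, ← sum_const]
      apply sum_congr rfl
      intro d hd
      rw [sum_comm]
      simp only [sum_char_right hψ h.nondeg]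
      rw [sum_eq_single_of_mem (-d) (hneg d hd)]
      · simp
      · intro e _ hne
        rw [if_neg]
        intro h0
        exact hne (eq_neg_of_add_eq_zero_right h0)
    simp only [hGψ] at this
    rw [hu]
    exact_mod_cast this
  -- the third moment
  have hS3 : u ^ 2 * (#D * (q - 2)) ≤ ∑ w, G w ^ 3 := by
    have : ∑ w, (∑ d ∈ D, ψ (B d w)) ^ 3
        = (Fintype.card V : ℂ) * ((∑ d ∈ D, #{e ∈ D | -(d + e) ∈ D} : ℕ) : ℂ) := by
      have hexp : ∀ a : V → ℂ, (∑ d ∈ D, a d) ^ 3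
          = ∑ d ∈ D, ∑ e ∈ D, ∑ i ∈ D, a d * a e * a i := by
        intro a
        rw [pow_succ, sq, sum_mul_sum, sum_mul]
        refine sum_congr rfl fun d _ => ?_
        rw [sum_mul]
        exact sum_congr rfl fun e _ => mul_sum _ _ _
      simp only [hexp, ← AddChar.map_add_eq_mul, ← LinearMap.add_apply, ← map_add]
      rw [sum_comm]
      push_cast
      rw [mul_sum]
      apply sum_congr rfl
      intro d hd
      rw [sum_comm]
      rw [card_filter]
      push_cast
      rw [mul_sum]
      apply sum_congr rfl
      intro e he
      rw [sum_comm]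
      simp only [sum_char_right hψ h.nondeg]
      have : ∀ i, d + e + i = 0 ↔ i = -(d + e) := fun i =>
        ⟨eq_neg_of_add_eq_zero_right, by rintro rfl; simp⟩
      simp only [this, sum_ite_eq']
      split_ifs <;> simp
    simp only [hGψ] at this
    have h3 : ∑ w, G w ^ 3 = (Fintype.card V : ℝ) * ((∑ d ∈ D, #{e ∈ D | -(d + e) ∈ D} : ℕ) : ℝ) := by
      exact_mod_cast this
    rw [h3, hu]
    apply mul_le_mul_of_nonneg_left _ (Nat.cast_nonneg _)
    push_cast
    rw [← nsmul_eq_mul, ← sum_const]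
    apply sum_le_sum
    intro d hd
    have hd0 : d ≠ 0 := fun h0 => hD0 (h0 ▸ hd)
    have hcard : #((Finset.univ : Finset F) \ {0, -1}) ≤ #{e ∈ D | -(d + e) ∈ D} := by
      apply card_le_card_of_injOn (fun c : F => c • d)
      · intro c hc
        simp only [coe_sdiff, coe_univ, coe_insert, coe_singleton, Set.mem_sdiff, Set.mem_univ,
          Set.mem_insert_iff, Set.mem_singleton_iff, true_and, not_or] at hc
        simp only [coe_filter, Set.mem_ofPred_eq]
        refine ⟨hsmul d hd c hc.1, ?_⟩
        have : -(d + c • d) = (-(1 + c)) • d := by module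
        rw [this]
        apply hsmul d hd
        intro h0
        apply hc.2
        linear_combination -h0
      · intro a _ b _ hab
        exact smul_left_injective F hd0 hab
    have h2 : Fintype.card F ≤ #((Finset.univ : Finset F) \ {0, -1}) + 2 := by
      have := le_card_sdiff ({0, -1} : Finset F) Finset.univ
      have := card_le_two (a := (0 : F)) (b := -1)
      rw [card_univ] at *
      omega
    have h4 : (Fintype.card F : ℝ) ≤ #{e ∈ D | -(d + e) ∈ D} + 2 := by
      exact_mod_cast h2.trans (Nat.add_le_add_right hcard 2)
    linarith
  -- sums of functions of the expected values of `G`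
  set E : V → ℝ := fun w => if w = 0 then N * (u + 1) else N - if w ∈ D then u else 0 with hE
  have hEsum : ∀ φ : ℝ → ℝ, ∑ w, φ (E w)
      = φ (N * (u + 1)) + #D * φ (N - u) + (u ^ 2 - 1 - #D) * φ N := by
    intro φ
    have hv : ∀ w, φ (E w) = φ N + (if w = 0 then φ (N * (u + 1)) - φ N else 0)
        + if w ∈ D then φ (N - u) - φ N else 0 := by
      intro w
      simp only [hE]
      by_cases hw : w = 0
      · subst hw
        simp [hD0]
      · by_cases hwD : w ∈ D <;> simp [hw, hwD]
    simp only [hv, sum_add_distrib, sum_ite_eq', mem_univ, if_true, sum_const, card_univ,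
      nsmul_eq_mul, sum_ite_mem, univ_inter]
    rw [← hu]
    ring
  have hGE : ∀ w, G w = E w := by
    have hZE : ∀ w, w ∈ Z → G w = E w := by
      intro w hw
      simp only [hE]
      split_ifs with h0 hD
      · rw [h0, hG0]
      · rw [hGZ w hw h0, if_pos hD]
      · rw [hGZ w hw h0, if_neg hD]
    have hE1 : ∑ w, E w = 0 := by
      have := hEsum fun x => x
      simp only [hDcard] at this
      rw [this]
      ring
    have hE2 : ∑ w, E w ^ 2 = u ^ 2 * #D := by
      have := hEsum fun x => x ^ 2
      simp only [hDcard] at this ⊢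
      rw [this]
      ring
    have hEN : ∀ w, w ∉ Z → E w = N := by
      intro w hw
      simp only [hE]
      rw [if_neg, if_neg, sub_zero]
      · exact fun hD => hw (hDZ w hD)
      · rintro rfl
        exact hw h.zero_mem
    have hzero : ∑ w, (G w - E w) ^ 2 = 0 := by
      have : ∀ w, (G w - E w) ^ 2 = G w ^ 2 - E w ^ 2 - 2 * N * (G w - E w) := by
        intro w
        by_cases hw : w ∈ Z
        · rw [hZE w hw]
          ring
        · rw [hEN w hw]
          ring
      simp only [this, sum_sub_distrib, ← mul_sum, hS1, hS2, hE1, hE2]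
      ring
    intro w
    have := (sum_eq_zero_iff_of_nonneg fun w _ => sq_nonneg (G w - E w)).1 hzero w (mem_univ w)
    linarith [pow_eq_zero_iff (two_ne_zero) |>.1 this]
  simp only [hGE] at hS3
  rw [hEsum fun x => x ^ 3] at hS3
  have hDpos : (0 : ℝ) < #D := by exact_mod_cast hDne.card_pos
  have hpos : 0 < u ^ 2 * #D := by positivity
  refine nonneg_of_mul_nonneg_right (?_ : 0 ≤ u ^ 2 * #D * _) hpos
  rw [hDcard] at hS3 ⊢
  linarith

end PolarGeometry

section Kinds

variable {F V : Type} [Field F] [AddCommGroup V] [Module F V]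

lemma isPolarGeometry_of_alternating {B : V →ₗ[F] V →ₗ[F] F}
    (hB : ∀ v, (∀ w, B v w = 0) → v = 0) (halt : ∀ v, B v v = 0) :
    IsPolarGeometry B Set.univ (Nat.card F) where
  nondeg := hB
  refl v w hvw := by
    have := halt (v + w)
    simpa [halt, hvw] using this
  self v _ := halt v
  zero_mem := Set.mem_univ _
  smul_mem _ _ _ := Set.mem_univ _
  add_mem _ _ _ _ _ := Set.mem_univ _
  card_line _ _ _ _ := by simp

lemma isPolarGeometry_of_quadraticForm {B : V →ₗ[F] V →ₗ[F] F}
    (hB : ∀ v, (∀ w, B v w = 0) → v = 0) {Q : QuadraticForm F V}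
    (hQ : ∀ v w, QuadraticMap.polar Q v w = B v w) :
    IsPolarGeometry B {v | Q v = 0} 1 := by
  have hadd : ∀ v w, Q (v + w) = Q v + Q w + B v w := by
    intro v w
    rw [← hQ, QuadraticMap.polar]
    ring
  have hsymm : ∀ v w, B v w = B w v := by
    intro v w
    rw [← hQ, ← hQ, QuadraticMap.polar_comm]
  refine ⟨hB, fun v w h => by rw [hsymm, h], ?_, ?_, ?_, ?_, ?_⟩
  · intro v hv
    have hv : Q v = 0 := hv
    rw [← hQ, QuadraticMap.polar_self, hv, smul_zero]
  · exact QuadraticMap.map_zero Q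
  · intro c v hv
    have hv : Q v = 0 := hv
    change Q (c • v) = 0
    rw [QuadraticMap.map_smul, hv, smul_zero]
  · intro v hv w hw hvw
    have hv : Q v = 0 := hv
    have hw : Q w = 0 := hw
    change Q (v + w) = 0
    rw [hadd, hv, hw, hvw]
    simp
  · intro x hx y hxy
    have hx : Q x = 0 := hx
    have key : ∀ c : F, y + c • x ∈ {v | Q v = 0} ↔ c = -(Q y) / B x y := by
      intro c
      change Q (y + c • x) = 0 ↔ _
      rw [hadd, QuadraticMap.map_smul, hx, smul_zero, map_smul, hsymm y x, eq_div_iff hxy,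
        smul_eq_mul]
      exact ⟨fun h => by linear_combination h, fun h => by linear_combination h⟩
    simp only [key]
    simp

lemma exists_add_eq_one_of_involution {σ : F →+* F} (hσ : σ ≠ RingHom.id F)
    (hσσ : ∀ a, σ (σ a) = a) : ∃ e, e + σ e = 1 := by
  obtain ⟨a, ha⟩ : ∃ a, a + σ a ≠ 0 := by
    by_contra! h
    apply hσ
    ext a
    have h1 := h 1
    rw [map_one] at h1
    rw [RingHom.id_apply]
    linear_combination h a - a * h1
  refine ⟨a / (a + σ a), ?_⟩
  rw [map_div₀, map_add, hσσ, add_comm (σ a) a, ← add_div, div_self ha]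

/-- The kernel of the relative trace of an involution has square root order. -/
lemma card_trace_zero_sq {σ : F →+* F} (hσ : σ ≠ RingHom.id F) (hσσ : ∀ a, σ (σ a) = a) :
    Nat.card {c : F // c + σ c = 0} ^ 2 = Nat.card F := by
  obtain ⟨e, he⟩ := exists_add_eq_one_of_involution hσ hσσ
  obtain ⟨a, ha⟩ : ∃ a, σ a ≠ a := by
    by_contra! h
    exact hσ (RingHom.ext h)
  have hd0 : a - σ a ≠ 0 := sub_ne_zero.2 ha.symm
  have hd : σ (a - σ a) = -(a - σ a) := by
    rw [map_sub, hσσ]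
    ring
  let e1 : {c : F // σ c = c} ≃ {c : F // c + σ c = 0} :=
    { toFun := fun t => ⟨(a - σ a) * t, by rw [map_mul, hd, t.2]; ring⟩
      invFun := fun c => ⟨c / (a - σ a), by
        rw [map_div₀, hd, eq_neg_of_add_eq_zero_right c.2, neg_div_neg_eq]⟩
      left_inv := fun t => by
        ext
        exact mul_div_cancel_left₀ _ hd0
      right_inv := fun c => by
        ext
        exact mul_div_cancel₀ _ hd0 }
  let e2 : F ≃ {c : F // c + σ c = 0} × {c : F // σ c = c} :=
    { toFun := fun x => (⟨x - e * (x + σ x), by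
          rw [map_sub, map_mul, map_add, hσσ]
          linear_combination (-(x + σ x)) * he⟩,
        ⟨x + σ x, by rw [map_add, hσσ, add_comm]⟩)
      invFun := fun p => p.1 + e * p.2
      left_inv := fun x => by simp
      right_inv := fun p => by
        obtain ⟨⟨c, hc⟩, ⟨t, ht⟩⟩ := p
        have h1 : c + e * t + σ (c + e * t) = t := by
          rw [map_add, map_mul, ht]
          linear_combination hc + t * he
        ext
        · simp only [h1]
          ring
        · exact h1 }
  rw [Nat.card_congr e2, Nat.card_prod, Nat.card_congr e1, sq]

lemma isPolarGeometry_of_hermitian {σ : F →+* F} (hσ : σ ≠ RingHom.id F)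
    (hσσ : ∀ a, σ (σ a) = a) {B : V →ₗ[F] V →ₛₗ[σ] F}
    (hB : ∀ v, (∀ w, B v w = 0) → v = 0) (hherm : ∀ v w, B w v = σ (B v w)) :
    IsPolarGeometry B {v | B v v = 0} (Nat.card {c : F // c + σ c = 0}) := by
  have hrefl : ∀ v w, B v w = 0 → B w v = 0 := fun v w h => by rw [hherm, h, map_zero]
  refine ⟨hB, hrefl, fun v hv => hv, by simp, ?_, ?_, ?_⟩
  · intro c v hv
    have hv : B v v = 0 := hv
    simp [hv]
  · intro v hv w hw hvw
    have hv : B v v = 0 := hv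
    have hw : B w w = 0 := hw
    simp [hv, hw, hvw, hrefl v w hvw]
  · intro x hx y hxy
    have hx : B x x = 0 := hx
    obtain ⟨e, he⟩ := exists_add_eq_one_of_involution hσ hσσ
    have hyy : σ (B y y) = B y y := (hherm y y).symm
    have key : ∀ c : F, y + c • x ∈ {v | B v v = 0} ↔
        (c * B x y + e * B y y) + σ (c * B x y + e * B y y) = 0 := by
      intro c
      change B (y + c • x) (y + c • x) = 0 ↔ _
      have : B (y + c • x) (y + c • x)
          = (c * B x y + e * B y y) + σ (c * B x y + e * B y y) := by
        simp only [map_add, LinearMap.add_apply, map_smul, LinearMap.smul_apply, map_smulₛₗ,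
          smul_eq_mul, hx, mul_zero, map_mul, ← hherm x y, hyy]
        linear_combination (-B y y) * he
      rw [this]
    simp only [key]
    refine Nat.card_congr (Equiv.subtypeEquiv
      ((Equiv.mulRight₀ (B x y) hxy).trans (Equiv.addRight (e * B y y))) fun c => ?_)
    simp

end Kinds

/-- The vectors of a polar space form a polar geometry. -/
lemma PolarSpace.exists_isPolarGeometry {F : Type} [Field F] [Fintype F] {r : ℕ} {k : PolarKind}
    (P : PolarSpace F r k) :
    ∃ (Z : Set (Fin (k.vdim r) → F)) (κ : ℕ), IsPolarGeometry P.B Z κ ∧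
      (∀ W, P.ti W ↔ IsTotSing P.B Z W) ∧ P.sing = {p | p.rep ∈ Z} ∧
      (κ : ℝ) * (Fintype.card F : ℝ) ^ ((r : ℝ) + k.e - 1) = (Fintype.card F : ℝ) ^ (r + 1) := by
  have hq : (0 : ℝ) < Fintype.card F := by exact_mod_cast Fintype.card_pos
  obtain ⟨σ, B, nondeg, sing, ti, spec, -, -⟩ := P
  cases k with
  | elliptic =>
    obtain ⟨rfl, Q, hQ, rfl, hti⟩ := spec
    refine ⟨_, _, isPolarGeometry_of_quadraticForm nondeg hQ, fun W => ?_, rfl, ?_⟩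
    · refine (hti W).trans ?_
      refine ⟨fun h => ⟨h, fun v hv w hw => ?_⟩, fun h => h.1⟩
      change B v w = 0
      rw [← hQ, QuadraticMap.polar, h _ (W.add_mem hv hw), h v hv, h w hw]
      simp
    · rw [Nat.cast_one, one_mul, ← Real.rpow_natCast]
      congr 1
      simp only [PolarKind.e]
      push_cast
      ring
  | symplectic =>
    obtain ⟨rfl, halt, rfl, hti⟩ := spec
    refine ⟨_, _, isPolarGeometry_of_alternating nondeg halt, fun W => ?_, by simp, ?_⟩
    · refine (hti W).trans ?_
      simp [IsTotSing]
    · simp only [PolarKind.e]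
      rw [add_sub_cancel_right, Real.rpow_natCast, Nat.card_eq_fintype_card]
      ring
  | hermitian =>
    obtain ⟨hσ, hσσ, hherm, rfl, hti⟩ := spec
    have hσσ' : ∀ a, σ (σ a) = a := fun a => RingHom.congr_fun hσσ a
    refine ⟨_, _, isPolarGeometry_of_hermitian hσ hσσ' nondeg hherm, fun W => ?_, rfl, ?_⟩
    · refine (hti W).trans ?_
      exact ⟨fun h => ⟨fun v hv => h v hv v hv, h⟩, fun h => h.2⟩
    · have h2 := card_trace_zero_sq hσ hσσ'
      rw [Nat.card_eq_fintype_card (α := F)] at h2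
      have h3 : ((Nat.card {c : F // c + σ c = 0} : ℕ) : ℝ)
          = (Fintype.card F : ℝ) ^ (1 / 2 : ℝ) := by
        rw [← h2, ← Real.sqrt_eq_rpow]
        push_cast
        rw [Real.sqrt_sq (Nat.cast_nonneg _)]
      rw [h3, ← Real.rpow_add hq, ← Real.rpow_natCast]
      congr 1
      simp only [PolarKind.e]
      push_cast
      ring

/-- The nonzero vectors spanning a point of `O`. -/
def cone {F V : Type} [Field F] [AddCommGroup V] [Module F V] (O : Set (Projectivization F V)) :
    Set V := {v | ∃ h : v ≠ 0, Projectivization.mk F v h ∈ O}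

lemma exists_smul_rep_of_mem_cone {F V : Type} [Field F] [AddCommGroup V] [Module F V]
    {O : Set (Projectivization F V)} {v : V} (hv : v ∈ cone O) :
    ∃ p ∈ O, ∃ c : Fˣ, v = c • p.rep := by
  obtain ⟨h, hO⟩ := hv
  obtain ⟨a, ha⟩ := Projectivization.exists_smul_eq_mk_rep F v h
  exact ⟨_, hO, a⁻¹, by rw [← ha, inv_smul_smul]⟩

lemma mk_smul_rep {F V : Type} [Field F] [AddCommGroup V] [Module F V]
    (p : Projectivization F V) (c : Fˣ) (h : c • p.rep ≠ 0) :
    Projectivization.mk F (c • p.rep) h = p := by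
  conv_rhs => rw [← p.mk_rep]
  exact (Projectivization.mk_eq_mk_iff F _ _ h p.rep_nonzero).2 ⟨c, rfl⟩

open Finset Classical in
lemma card_cone_inter {F V : Type} [Field F] [Fintype F] [AddCommGroup V] [Module F V] [Fintype V]
    (O : Set (Projectivization F V)) (W : Submodule F V) :
    #{d ∈ (cone O).toFinset | d ∈ W} = (pts W ∩ O).ncard * (Fintype.card F - 1) := by
  have : Fintype (Projectivization F V) := Fintype.ofFinite _
  rw [Set.ncard_eq_toFinset_card', ← Fintype.card_units, ← card_univ, ← card_product]
  symm
  have hne : ∀ (p : Projectivization F V) (c : Fˣ), c • p.rep ≠ 0 := fun p c h =>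
    p.rep_nonzero ((smul_eq_zero_iff_eq c).1 h)
  refine card_bij (fun p _ => p.2 • p.1.rep) ?_ ?_ ?_
  · rintro ⟨p, c⟩ hp
    simp only [mem_product, Set.mem_toFinset, mem_univ, and_true] at hp
    simp only [mem_filter, Set.mem_toFinset]
    exact ⟨⟨hne p c, by rw [mk_smul_rep]; exact hp.2⟩, W.smul_mem (c : F) hp.1⟩
  · rintro ⟨p, c⟩ _ ⟨p', c'⟩ _ h
    simp only at h
    have hp : p = p' := by
      rw [← mk_smul_rep p c (hne p c), ← mk_smul_rep p' c' (hne p' c')]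
      simp only [h]
    subst hp
    have : (c : F) = c' := smul_left_injective F p.rep_nonzero h
    rw [Units.ext this]
  · intro v hv
    simp only [mem_filter, Set.mem_toFinset] at hv
    obtain ⟨p, hp, c, rfl⟩ := exists_smul_rep_of_mem_cone hv.1
    refine ⟨(p, c), ?_, rfl⟩
    simp only [mem_product, Set.mem_toFinset, mem_univ, and_true]
    refine ⟨?_, hp⟩
    have := W.smul_mem ((c⁻¹ : Fˣ) : F) hv.2
    change c⁻¹ • c • p.rep ∈ W at this
    rwa [inv_smul_smul] at this

/-- Theorem 4.2: if `O` is a non-trivial `m`-ovoid of `P'_{r,e}` with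
`m ≥ 2`, then `(q−1)²·m² + 3(q−1)·m − q^{r+e−1} − q + 2 ≥ 0`. -/
theorem ovoid_quadratic_inequality
    {F : Type} [Field F] [Fintype F] {q r m : ℕ} (hq : Fintype.card F = q)
    {k : PolarKind} (P : PolarSpace F r k)
    (O : Set (Projectivization F (Fin (k.vdim r) → F)))
    (hO : P.IsNontrivialMOvoid m O) (hm : 2 ≤ m) :
    ((q : ℝ) - 1) ^ 2 * (m : ℝ) ^ 2 + 3 * ((q : ℝ) - 1) * (m : ℝ)
        - (q : ℝ) ^ ((r : ℝ) + k.e - 1) - (q : ℝ) + 2 ≥ 0 := by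
  classical
  obtain ⟨⟨hOs, hOm⟩, hm0, -⟩ := hO
  obtain ⟨Z, κ, hZ, hti, hsing, hκ⟩ := P.exists_isPolarGeometry
  have hq1 : 1 < Fintype.card F := Fintype.one_lt_card
  have hq0 : (0 : ℝ) < Fintype.card F := by exact_mod_cast Fintype.card_pos
  have hu : ((Fintype.card F : ℝ) ^ ((r : ℝ) + k.e - 1)) ^ 2
      = Fintype.card (Fin (k.vdim r) → F) := by
    rw [Fintype.card_fun, Fintype.card_fin, ← Real.rpow_natCast, ← Real.rpow_mul hq0.le]
    push_cast
    rw [← Real.rpow_natCast]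
    congr 1
    cases k <;> simp only [PolarKind.e, PolarKind.vdim] <;> push_cast <;> ring
  have hgen : ∀ U, IsTotSing P.B Z U → Module.finrank F U = r →
      (((cone O).toFinset.filter fun d => d ∈ U).card : ℝ) = ((q : ℝ) - 1) * m := by
    intro U hU hr
    rw [card_cone_inter, hOm U ⟨(hti U).2 hU, hr⟩, Nat.cast_mul, Nat.cast_sub hq1.le, hq]
    push_cast
    ring
  have hex : ∃ U, IsTotSing P.B Z U ∧ Module.finrank F U = r := by
    obtain ⟨W, hW, hr⟩ := P.rank_exists
    exact ⟨W, (hti W).1 hW, hr⟩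
  have key := hZ.quadratic_inequality (D := (cone O).toFinset) (N := ((q : ℝ) - 1) * m)
    (Real.rpow_pos_of_pos hq0 _) hu hκ (fun U hU => P.rank_le U ((hti U).2 hU)) hex
    (by
      intro d hd
      obtain ⟨p, hp, c, rfl⟩ := exists_smul_rep_of_mem_cone (Set.mem_toFinset.1 hd)
      have hpZ := hOs hp
      rw [hsing] at hpZ
      exact hZ.smul_mem c _ hpZ)
    (fun h0 => (Set.mem_toFinset.1 h0).1 rfl)
    (by
      intro d hd c hc
      obtain ⟨p, hp, a, rfl⟩ := exists_smul_rep_of_mem_cone (Set.mem_toFinset.1 hd)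
      have h1 : c • a • p.rep = (Units.mk0 c hc * a) • p.rep := by
        rw [mul_smul]
        rfl
      have h2 : (Units.mk0 c hc * a) • p.rep ≠ 0 := fun h =>
        p.rep_nonzero ((smul_eq_zero_iff_eq _).1 h)
      rw [Set.mem_toFinset, h1]
      exact ⟨h2, by rwa [mk_smul_rep]⟩)
    (by
      obtain ⟨W, hW, hr⟩ := hex
      have h1 := hgen W hW hr
      rw [← hq] at h1
      have h2 : (0 : ℝ) < ((Fintype.card F : ℝ) - 1) * m := by
        have : (1 : ℝ) < Fintype.card F := by exact_mod_cast hq1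
        have : (0 : ℝ) < m := by exact_mod_cast hm0
        exact mul_pos (by linarith) this
      rw [← h1] at h2
      have h3 := Finset.card_pos.1 (by exact_mod_cast h2)
      exact h3.mono (Finset.filter_subset _ _))
    hgen
  rw [hq] at key
  linarith

end PolarOvoids
end
end
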